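/- Let p, q ∈ [2, ∞) with q < p. There exist constants c, C ∈ (0, ∞) depending only on p and q such that for every m, n ∈ ℕ, the L_p distortion of the grid [m]_q^n satisfies c · min{ n^{(p−q)(q−2)/(q²(p−2))}, m^{1−2/q} } ≤ c_p([m]_q^n) ≤ C · min{ n^{(p−q)(q−2)/(q²(p−2))}, m^{1−2/q} }. -/

import Mathlib

open Finset

/-- The Lebesgue space `L_p(ℝ)` (with `p ∈ [1,∞)` given as a real number). -/
noncomputable abbrev LpSpace (p : ℝ) :=
  MeasureTheory.Lp ℝ (ENNReal.ofReal p) (MeasureTheory.volume : MeasureTheory.Measure ℝ)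

/-- The `ℓ_q^n` metric on `ℝ^n`: `d(x,y) = (Σ_i |x_i - y_i|^q)^{1/q}`. -/
noncomputable def lqDist {n : ℕ} (q : ℝ) (x y : Fin n → ℝ) : ℝ :=
  (∑ i, |x i - y i| ^ q) ^ (1 / q)

/-- The `ℓ_q^n` metric on the grid `{1,…,m}^n` (encoded as `Fin n → Fin m`). -/
noncomputable def gridDist (q : ℝ) {n m : ℕ} (x y : Fin n → Fin m) : ℝ :=
  lqDist q (fun i => ((x i : ℕ) : ℝ)) (fun i => ((y i : ℕ) : ℝ))

/-- The `L_p` distortion `c_p(X, d)` of a distance function `d` on `X`: the infimum of those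
`D ∈ [1,∞)` for which there is `f : X → L_p` with
`d(x,y) ≤ ‖f(x) - f(y)‖_{L_p} ≤ D d(x,y)` for all `x, y ∈ X`. -/
noncomputable def LpDistortion (p : ℝ) {X : Type*} (d : X → X → ℝ) : ℝ :=
  sInf {D : ℝ | 1 ≤ D ∧ ∃ f : X → LpSpace p,
    ∀ x y : X, d x y ≤ ‖f x - f y‖ ∧ ‖f x - f y‖ ≤ D * d x y}

section ProductExpectation

variable {ι α : Type*} [Fintype ι] [DecidableEq ι] [Fintype α]

/-- Expectation of `F` when the coordinates `w j` are independent with weights `κ j`. -/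
noncomputable def pexp (κ : ι → α → ℝ) (F : (ι → α) → ℝ) : ℝ :=
  ∑ w, (∏ j, κ j (w j)) * F w

/-- Each `κ j` is a probability weight. -/
structure IsProbWeight (κ : ι → α → ℝ) : Prop where
  nonneg : ∀ j a, 0 ≤ κ j a
  sum_eq_one : ∀ j, ∑ a, κ j a = 1

variable {κ : ι → α → ℝ}

lemma IsProbWeight.prod_nonneg {ι α : Type*} [Fintype ι] [Fintype α] {κ : ι → α → ℝ}
    (hκ : IsProbWeight κ)
    (w : ι → α) : 0 ≤ ∏ j, κ j (w j) :=
  Finset.prod_nonneg fun j _ => hκ.nonneg j _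

lemma pexp_add (F G : (ι → α) → ℝ) : pexp κ (fun w => F w + G w) = pexp κ F + pexp κ G := by
  simp [pexp, mul_add, sum_add_distrib]

lemma pexp_sub (F G : (ι → α) → ℝ) : pexp κ (fun w => F w - G w) = pexp κ F - pexp κ G := by
  simp [pexp, mul_sub, sum_sub_distrib]

lemma pexp_const_mul (c : ℝ) (F : (ι → α) → ℝ) :
    pexp κ (fun w => c * F w) = c * pexp κ F := by
  simp only [pexp, mul_sum]
  exact sum_congr rfl fun w _ => by ring

lemma pexp_sum {β : Type*} (s : Finset β) (F : β → (ι → α) → ℝ) :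
    pexp κ (fun w => ∑ b ∈ s, F b w) = ∑ b ∈ s, pexp κ (F b) := by
  simp only [pexp, mul_sum]
  exact sum_comm

lemma pexp_comm {ι' α' : Type*} [Fintype ι'] [DecidableEq ι'] [Fintype α'] (κ : ι → α → ℝ)
    (κ' : ι' → α' → ℝ) (F : (ι → α) → (ι' → α') → ℝ) :
    pexp κ (fun w => pexp κ' (F w)) = pexp κ' (fun v => pexp κ (fun w => F w v)) := by
  simp only [pexp, mul_sum]
  rw [sum_comm]
  exact sum_congr rfl fun w _ => sum_congr rfl fun v _ => by ring

lemma pexp_mono (hκ : IsProbWeight κ) {F G : (ι → α) → ℝ} (h : ∀ w, F w ≤ G w) :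
    pexp κ F ≤ pexp κ G :=
  sum_le_sum fun w _ => mul_le_mul_of_nonneg_left (h w) (hκ.prod_nonneg w)

lemma pexp_nonneg (hκ : IsProbWeight κ) {F : (ι → α) → ℝ} (h : ∀ w, 0 ≤ F w) :
    0 ≤ pexp κ F :=
  sum_nonneg fun w _ => mul_nonneg (hκ.prod_nonneg w) (h w)

lemma pexp_prod (κ : ι → α → ℝ) (φ : ι → α → ℝ) :
    pexp κ (fun w => ∏ j, φ j (w j)) = ∏ j, ∑ a, κ j a * φ j a := by
  rw [Finset.prod_univ_sum, Fintype.piFinset_univ]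
  simp [pexp, prod_mul_distrib]

lemma IsProbWeight.sum_prod (hκ : IsProbWeight κ) : ∑ w : ι → α, ∏ j, κ j (w j) = 1 := by
  have := pexp_prod κ (fun _ _ => 1)
  simpa [pexp, hκ.sum_eq_one] using this

lemma pexp_const (hκ : IsProbWeight κ) (c : ℝ) : pexp κ (fun _ => c) = c := by
  rw [pexp, ← sum_mul, hκ.sum_prod, one_mul]

/-- Resampling one coordinate does not change the expectation. -/
lemma pexp_resample (hκ : IsProbWeight κ) (j : ι) (F : (ι → α) → ℝ) :
    pexp κ (fun w => ∑ a, κ j a * F (Function.update w j a)) = pexp κ F := by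
  let σ : (ι → α) × α → (ι → α) × α := fun x => (Function.update x.1 j x.2, x.1 j)
  have hσ : Function.Involutive σ := by
    rintro ⟨w, a⟩
    simp [σ]
  have hprod : ∀ w a, (∏ i, κ i (Function.update w j a i)) * κ j (w j) =
      (∏ i, κ i (w i)) * κ j a := by
    intro w a
    rw [← mul_prod_erase univ (fun i => κ i (Function.update w j a i)) (mem_univ j),
      ← mul_prod_erase univ (fun i => κ i (w i)) (mem_univ j)]
    have : ∏ i ∈ univ.erase j, κ i (Function.update w j a i) = ∏ i ∈ univ.erase j, κ i (w i) :=
      prod_congr rfl fun i hi => by rw [Function.update_of_ne (ne_of_mem_erase hi)]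
    rw [this, Function.update_self]
    ring
  calc pexp κ (fun w => ∑ a, κ j a * F (Function.update w j a))
      = ∑ x : (ι → α) × α, (∏ i, κ i (x.1 i)) * κ j x.2 * F (Function.update x.1 j x.2) := by
        rw [Fintype.sum_prod_type]
        simp only [pexp, mul_sum]
        exact sum_congr rfl fun w _ => sum_congr rfl fun a _ => by ring
    _ = ∑ x : (ι → α) × α, (∏ i, κ i (x.1 i)) * κ j x.2 * F x.1 := by
        refine Fintype.sum_equiv hσ.toPerm _ _ ?_
        rintro ⟨w, a⟩
        simp only [Function.Involutive.coe_toPerm, σ]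
        rw [hprod]
    _ = pexp κ F := by
        rw [Fintype.sum_prod_type, pexp]
        refine sum_congr rfl fun w _ => ?_
        change ∑ a, (∏ i, κ i (w i)) * κ j a * F w = _
        rw [← sum_mul, ← mul_sum, hκ.sum_eq_one, mul_one]

/-- A function of the coordinate `j` is independent of a function of the other coordinates. -/
lemma pexp_mul_of_update (hκ : IsProbWeight κ) (j : ι) (s : α → ℝ) (F : (ι → α) → ℝ)
    (hF : ∀ w a, F (Function.update w j a) = F w) :
    pexp κ (fun w => s (w j) * F w) = (∑ a, κ j a * s a) * pexp κ F := by
  rw [← pexp_resample hκ j, ← pexp_const_mul]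
  congr 1
  funext w
  rw [sum_mul]
  refine sum_congr rfl fun a _ => ?_
  rw [hF, Function.update_self, mul_assoc]

lemma pexp_coord (hκ : IsProbWeight κ) (j : ι) (s : α → ℝ) :
    pexp κ (fun w => s (w j)) = ∑ a, κ j a * s a := by
  have := pexp_mul_of_update hκ j s (fun _ => 1) (fun _ _ => rfl)
  simpa [pexp_const hκ] using this

/-- Composition of product kernels. -/
lemma pexp_pexp (κ : ι → α → ℝ) (K : ι → α → α → ℝ) (F : (ι → α) → ℝ) :
    pexp κ (fun y => pexp (fun j => K j (y j)) F) = pexp (fun j b => ∑ a, κ j a * K j a b) F := by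
  simp only [pexp, mul_sum]
  rw [sum_comm]
  refine sum_congr rfl fun w _ => ?_
  have := pexp_prod κ (fun j a => K j a (w j))
  rw [← this, pexp, sum_mul]
  exact sum_congr rfl fun v _ => by ring

lemma pexp_rpow_le (hκ : IsProbWeight κ) {r : ℝ} (hr : 1 ≤ r) {F : (ι → α) → ℝ}
    (hF : ∀ w, 0 ≤ F w) : pexp κ F ^ r ≤ pexp κ (fun w => F w ^ r) :=
  Real.rpow_arith_mean_le_arith_mean_rpow _ _ _ (fun w _ => hκ.prod_nonneg w) hκ.sum_prod
    (fun w _ => hF w) hr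

lemma abs_pexp_le (hκ : IsProbWeight κ) (F : (ι → α) → ℝ) :
    |pexp κ F| ≤ pexp κ (fun w => |F w|) := by
  refine (abs_sum_le_sum_abs _ _).trans (le_of_eq (sum_congr rfl fun w _ => ?_))
  rw [abs_mul, abs_of_nonneg (hκ.prod_nonneg w)]

lemma abs_pexp_rpow_le (hκ : IsProbWeight κ) {r : ℝ} (hr : 1 ≤ r) (F : (ι → α) → ℝ) :
    |pexp κ F| ^ r ≤ pexp κ (fun w => |F w| ^ r) :=
  (Real.rpow_le_rpow (abs_nonneg _) (abs_pexp_le hκ F) (by linarith)).trans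
    (pexp_rpow_le hκ hr fun _ => abs_nonneg _)

/-- Orthogonality of centred functions of distinct coordinates. -/
lemma pexp_sq_sum (hκ : IsProbWeight κ) (s : ι → α → ℝ) (hs : ∀ j, ∑ a, κ j a * s j a = 0)
    (c : ι → ℝ) :
    pexp κ (fun w => (∑ j, c j * s j (w j)) ^ 2) = ∑ j, c j ^ 2 * ∑ a, κ j a * s j a ^ 2 := by
  have key : ∀ i j, pexp κ (fun w => s i (w i) * s j (w j)) =
      if i = j then ∑ a, κ j a * s j a ^ 2 else 0 := by
    intro i j
    split_ifs with h
    · subst h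
      rw [← pexp_coord hκ]
      simp only [sq]
    · rw [pexp_mul_of_update hκ i (s i) (fun w => s j (w j)), hs, zero_mul]
      intro w a
      rw [Function.update_of_ne (Ne.symm h)]
  calc pexp κ (fun w => (∑ j, c j * s j (w j)) ^ 2)
      = pexp κ (fun w => ∑ i, ∑ j, (c i * c j) * (s i (w i) * s j (w j))) := by
        congr 1; funext w
        rw [sq, sum_mul_sum]
        exact sum_congr rfl fun i _ => sum_congr rfl fun j _ => by ring
    _ = ∑ i, ∑ j, (c i * c j) * (if i = j then ∑ a, κ j a * s j a ^ 2 else 0) := by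
        rw [pexp_sum]
        refine sum_congr rfl fun i _ => ?_
        rw [pexp_sum]
        refine sum_congr rfl fun j _ => ?_
        rw [pexp_const_mul, key]
    _ = _ := by
        refine sum_congr rfl fun i _ => ?_
        simp [sq]

/-- Bessel's inequality for centred functions of distinct coordinates. -/
lemma bessel_pexp (hκ : IsProbWeight κ) (s : ι → α → ℝ) (hs : ∀ j, ∑ a, κ j a * s j a = 0)
    {B : ℝ} (hB : 0 < B) (hsB : ∀ j, ∑ a, κ j a * s j a ^ 2 ≤ B) (F : (ι → α) → ℝ) :
    ∑ j, pexp κ (fun w => s j (w j) * F w) ^ 2 ≤ B * pexp κ (fun w => F w ^ 2) := by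
  set c : ι → ℝ := fun j => pexp κ (fun w => s j (w j) * F w) with hc
  set T := ∑ j, c j ^ 2 with hT
  have h1 : pexp κ (fun w => (∑ j, c j * s j (w j)) ^ 2) ≤ B * T := by
    rw [pexp_sq_sum hκ s hs, hT, mul_sum]
    refine sum_le_sum fun j _ => ?_
    rw [mul_comm]
    exact mul_le_mul_of_nonneg_right (hsB j) (sq_nonneg _)
  have h2 : pexp κ (fun w => (∑ j, c j * s j (w j)) * F w) = T := by
    have : (fun w : ι → α => (∑ j, c j * s j (w j)) * F w) =
        fun w => ∑ j, c j * (s j (w j) * F w) := by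
      funext w
      rw [sum_mul]
      exact sum_congr rfl fun j _ => by ring
    rw [this, pexp_sum]
    refine sum_congr rfl fun j _ => ?_
    rw [pexp_const_mul, sq]
  have h3 : 0 ≤ pexp κ (fun w => (B * F w - ∑ j, c j * s j (w j)) ^ 2) :=
    pexp_nonneg hκ fun w => sq_nonneg _
  have h4 : pexp κ (fun w => (B * F w - ∑ j, c j * s j (w j)) ^ 2) =
      B ^ 2 * pexp κ (fun w => F w ^ 2) - 2 * B * T +
        pexp κ (fun w => (∑ j, c j * s j (w j)) ^ 2) := by
    rw [← h2, ← pexp_const_mul, ← pexp_const_mul, ← pexp_sub, ← pexp_add]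
    congr 1; funext w; ring
  have : B * T ≤ B * (B * pexp κ (fun w => F w ^ 2)) := by nlinarith
  exact le_of_mul_le_mul_left this hB

end ProductExpectation

section EfronStein

/-- The variance of `φ` with respect to the weight `κ`. -/
noncomputable def wvar {α : Type*} [Fintype α] (κ : α → ℝ) (φ : α → ℝ) : ℝ :=
  ∑ a, κ a * φ a ^ 2 - (∑ a, κ a * φ a) ^ 2

lemma wvar_eq_sum_sum {α : Type*} [Fintype α] {κ : α → ℝ} (hκ : ∑ a, κ a = 1) (φ : α → ℝ) :
    wvar κ φ = 1 / 2 * ∑ a, ∑ b, κ a * κ b * (φ a - φ b) ^ 2 := by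
  have h1 : ∑ a, ∑ b, κ a * κ b * (φ a - φ b) ^ 2 =
      ∑ a, ∑ b, (κ a * φ a ^ 2) * κ b - 2 * ∑ a, ∑ b, (κ a * φ a) * (κ b * φ b) +
        ∑ a, ∑ b, κ a * (κ b * φ b ^ 2) := by
    simp only [mul_sum, ← sum_sub_distrib, ← sum_add_distrib]
    exact sum_congr rfl fun a _ => sum_congr rfl fun b _ => by ring
  rw [h1, ← sum_mul_sum, ← sum_mul_sum, ← sum_mul_sum, hκ, wvar]
  ring

variable {α : Type*} [Fintype α]

lemma pexp_cons {n : ℕ} (κ : Fin (n + 1) → α → ℝ) (F : (Fin (n + 1) → α) → ℝ) :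
    pexp κ F = ∑ a, κ 0 a * pexp (fun j => κ j.succ) (fun v => F (Fin.cons a v)) := by
  rw [pexp, ← Equiv.sum_comp (Fin.consEquiv fun _ => α), Fintype.sum_prod_type]
  refine sum_congr rfl fun a _ => ?_
  rw [pexp, mul_sum]
  refine sum_congr rfl fun v _ => ?_
  simp [Fin.prod_univ_succ, Fin.consEquiv, mul_assoc]

lemma wvar_pexp_le {n : ℕ} {κ₀ : α → ℝ} (h0 : ∀ a, 0 ≤ κ₀ a) (h1 : ∑ a, κ₀ a = 1)
    {κ : Fin n → α → ℝ} (hκ : IsProbWeight κ) (g : α → (Fin n → α) → ℝ) :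
    wvar κ₀ (fun a => pexp κ (g a)) ≤ pexp κ (fun v => wvar κ₀ (fun a => g a v)) := by
  have h2 : pexp κ (fun v => wvar κ₀ (fun a => g a v)) =
      1 / 2 * ∑ a, ∑ b, κ₀ a * κ₀ b * pexp κ (fun v => (g a v - g b v) ^ 2) := by
    simp only [wvar_eq_sum_sum h1, pexp_const_mul, pexp_sum]
  rw [h2, wvar_eq_sum_sum h1]
  refine mul_le_mul_of_nonneg_left (sum_le_sum fun a _ => sum_le_sum fun b _ =>
    mul_le_mul_of_nonneg_left ?_ (mul_nonneg (h0 a) (h0 b))) (by norm_num)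
  rw [← pexp_sub]
  have := abs_pexp_rpow_le hκ one_le_two (fun v => g a v - g b v)
  simpa using this

/-- The Efron–Stein inequality. -/
lemma efron_stein {n : ℕ} {κ : Fin n → α → ℝ} (hκ : IsProbWeight κ) (g : (Fin n → α) → ℝ) :
    pexp κ (fun w => g w ^ 2) - pexp κ g ^ 2 ≤
      ∑ j, pexp κ (fun w => wvar (κ j) (fun a => g (Function.update w j a))) := by
  induction n with
  | zero => simp [pexp]
  | succ n ih =>
    have hκ' : IsProbWeight fun j : Fin n => κ j.succ :=
      ⟨fun j a => hκ.nonneg _ _, fun j => hκ.sum_eq_one _⟩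
    have key : ∀ j : Fin n,
        pexp κ (fun w => wvar (κ j.succ) (fun a => g (Function.update w j.succ a))) =
        ∑ b, κ 0 b * pexp (fun j : Fin n => κ j.succ) (fun v => wvar (κ j.succ)
          (fun a => g (Fin.cons b (Function.update v j a)))) := by
      intro j
      rw [pexp_cons]
      simp only [Fin.cons_update]
    have key0 : pexp κ (fun w => wvar (κ 0) (fun a => g (Function.update w 0 a))) =
        pexp (fun j : Fin n => κ j.succ) (fun v => wvar (κ 0) (fun a => g (Fin.cons a v))) := by
      rw [pexp_cons]
      simp only [Fin.update_cons_zero]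
      rw [← sum_mul, hκ.sum_eq_one, one_mul]
    rw [Fin.sum_univ_succ, key0, pexp_cons, pexp_cons κ g, sum_congr rfl fun j _ => key j, sum_comm]
    have h1 := wvar_pexp_le (hκ.nonneg 0) (hκ.sum_eq_one 0) hκ' (fun a v => g (Fin.cons a v))
    have h2 : ∀ b, κ 0 b * pexp (fun j : Fin n => κ j.succ) (fun v => g (Fin.cons b v) ^ 2) ≤
        κ 0 b * pexp (fun j : Fin n => κ j.succ) (fun v => g (Fin.cons b v)) ^ 2 +
        ∑ j, κ 0 b * pexp (fun j : Fin n => κ j.succ) (fun v => wvar (κ j.succ)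
          (fun a => g (Fin.cons b (Function.update v j a)))) := by
      intro b
      have := mul_le_mul_of_nonneg_left (ih hκ' (fun v => g (Fin.cons b v))) (hκ.nonneg 0 b)
      rw [← mul_sum]
      linarith
    have h3 := sum_le_sum fun b (_ : b ∈ univ) => h2 b
    rw [sum_add_distrib] at h3
    rw [wvar] at h1
    linarith

end EfronStein

section SignedPower

/-- The odd extension of `t ↦ t ^ s`. -/
noncomputable def spow (s t : ℝ) : ℝ := SignType.sign t * |t| ^ s

lemma spow_sq {p : ℝ} (hp : 2 ≤ p) (t : ℝ) : spow (p / 2) t ^ 2 = |t| ^ p := by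
  rcases eq_or_ne t 0 with rfl | ht
  · simp [spow, Real.zero_rpow (by linarith : p ≠ 0)]
  · have : ((SignType.sign t : SignType) : ℝ) ^ 2 = 1 := by
      rcases lt_or_gt_of_ne ht with h | h
      · simp [h]
      · simp [h]
    rw [spow, mul_pow, this, one_mul, ← Real.rpow_natCast, ← Real.rpow_mul (abs_nonneg _)]
    congr 1
    push_cast
    ring

lemma spow_of_nonneg {s t : ℝ} (hs : 0 < s) (ht : 0 ≤ t) : spow s t = t ^ s := by
  rcases ht.eq_or_lt with rfl | ht
  · simp [spow, Real.zero_rpow hs.ne']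
  · simp [spow, ht, abs_of_pos ht]

lemma spow_neg (s t : ℝ) : spow s (-t) = -spow s t := by
  simp [spow, Left.sign_neg]

lemma rpow_sub_rpow_le {s a b : ℝ} (hs : 1 ≤ s) (hb : 0 ≤ b) (hab : b ≤ a) :
    a ^ s - b ^ s ≤ s * a ^ (s - 1) * (a - b) := by
  rcases (hb.trans hab).eq_or_lt with h | ha
  · have : b = 0 := by linarith
    subst this; rw [← h]; simp
  · have h1 := one_add_mul_self_le_rpow_one_add (s := b / a - 1) (p := s)
      (by have : 0 ≤ b / a := by positivity
          linarith) hs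
    have h2 : (1 + (b / a - 1)) ^ s = b ^ s / a ^ s := by
      rw [← Real.div_rpow hb ha.le]; congr 1; ring
    rw [h2] at h1
    have h3 : a ^ s = a ^ (s - 1) * a := by
      rw [← Real.rpow_add_one ha.ne']; congr 1; ring
    have h4 : 0 < a ^ s := Real.rpow_pos_of_pos ha s
    rw [le_div_iff₀ h4] at h1
    have h5 : (1 + s * (b / a - 1)) * a ^ s = a ^ s - s * a ^ (s - 1) * (a - b) := by
      rw [h3]; field_simp; ring
    linarith

lemma abs_spow_sub_le {s : ℝ} (hs : 1 ≤ s) (a b : ℝ) :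
    |spow s a - spow s b| ≤ s * max |a| |b| ^ (s - 1) * |a - b| := by
  have hs0 : 0 < s := by linarith
  -- two nonnegative arguments
  have pos : ∀ a b : ℝ, 0 ≤ b → b ≤ a →
      |spow s a - spow s b| ≤ s * max |a| |b| ^ (s - 1) * |a - b| := by
    intro a b hb hab
    have ha := hb.trans hab
    rw [spow_of_nonneg hs0 ha, spow_of_nonneg hs0 hb, abs_of_nonneg ha, abs_of_nonneg hb,
      max_eq_left hab, abs_of_nonneg (sub_nonneg.2 hab), abs_of_nonneg]
    · exact rpow_sub_rpow_le hs hb hab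
    · exact sub_nonneg.2 (Real.rpow_le_rpow hb hab hs0.le)
  have mixed : ∀ a b : ℝ, 0 ≤ a → b ≤ 0 →
      |spow s a - spow s b| ≤ s * max |a| |b| ^ (s - 1) * |a - b| := by
    intro a b ha hb
    obtain ⟨c, rfl⟩ : ∃ c, b = -c := ⟨-b, by ring⟩
    have hc : 0 ≤ c := by linarith
    rw [spow_neg, spow_of_nonneg hs0 ha, spow_of_nonneg hs0 hc, abs_neg, abs_of_nonneg ha,
      abs_of_nonneg hc, sub_neg_eq_add, sub_neg_eq_add, abs_of_nonneg (by positivity),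
      abs_of_nonneg (by positivity)]
    have h : ∀ t, 0 ≤ t → t ≤ max a c → t ^ s ≤ max a c ^ (s - 1) * t := by
      intro t ht htm
      rcases ht.eq_or_lt with rfl | ht
      · simp [Real.zero_rpow hs0.ne']
      · have : t ^ s = t ^ (s - 1) * t := by
          rw [← Real.rpow_add_one ht.ne']; congr 1; ring
        rw [this]
        exact mul_le_mul_of_nonneg_right (Real.rpow_le_rpow ht.le htm (by linarith)) ht.le
    have h1 := h a ha (le_max_left _ _)
    have h2 := h c hc (le_max_right _ _)
    have h3 : 0 ≤ max a c ^ (s - 1) * (a + c) := by positivity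
    nlinarith
  have all : ∀ a b : ℝ, b ≤ a →
      |spow s a - spow s b| ≤ s * max |a| |b| ^ (s - 1) * |a - b| := by
    intro a b hab
    rcases le_total 0 b with hb | hb
    · exact pos a b hb hab
    · rcases le_total 0 a with ha | ha
      · exact mixed a b ha hb
      · have := pos (-b) (-a) (by linarith) (by linarith)
        rwa [spow_neg, spow_neg, abs_neg, abs_neg, max_comm, neg_sub_neg, neg_sub_neg] at this
  rcases le_total b a with h | h
  · exact all a b h
  · rw [abs_sub_comm, abs_sub_comm a b, max_comm]
    exact all b a h

lemma continuous_spow {s : ℝ} (hs : 1 ≤ s) : Continuous (spow s) := by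
  have hs0 : 0 < s := by linarith
  have : spow s = fun t => (max t 0) ^ s - (max (-t) 0) ^ s := by
    funext t
    rcases le_total 0 t with h | h
    · rw [spow_of_nonneg hs0 h, max_eq_left h, max_eq_right (by linarith)]
      simp [Real.zero_rpow hs0.ne']
    · rw [← neg_neg t, spow_neg, spow_of_nonneg hs0 (by linarith), neg_neg,
        max_eq_left (by linarith : 0 ≤ -t), max_eq_right h]
      simp [Real.zero_rpow hs0.ne']
  rw [this]
  exact ((continuous_id.max continuous_const).rpow_const fun _ => Or.inr hs0.le).sub
    ((continuous_neg.max continuous_const).rpow_const fun _ => Or.inr hs0.le)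

lemma abs_spow_sub_sq_le {p : ℝ} (hp : 2 ≤ p) (a b : ℝ) :
    (spow (p / 2) a - spow (p / 2) b) ^ 2 ≤
      (p / 2) ^ 2 * (|a| ^ (p - 2) + |b| ^ (p - 2)) * (a - b) ^ 2 := by
  have h := abs_spow_sub_le (s := p / 2) (by linarith) a b
  have h2 : (max |a| |b| ^ (p / 2 - 1)) ^ 2 ≤ |a| ^ (p - 2) + |b| ^ (p - 2) := by
    rw [← Real.rpow_natCast, ← Real.rpow_mul (by positivity)]
    have : (p / 2 - 1) * ((2 : ℕ) : ℝ) = p - 2 := by push_cast; ring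
    rw [this]
    rcases le_total |a| |b| with h | h
    · rw [max_eq_right h]
      have : 0 ≤ |a| ^ (p - 2) := by positivity
      linarith
    · rw [max_eq_left h]
      have : 0 ≤ |b| ^ (p - 2) := by positivity
      linarith
  calc (spow (p / 2) a - spow (p / 2) b) ^ 2 = |spow (p / 2) a - spow (p / 2) b| ^ 2 :=
        (sq_abs _).symm
    _ ≤ (p / 2 * max |a| |b| ^ (p / 2 - 1) * |a - b|) ^ 2 := by gcongr
    _ = (p / 2) ^ 2 * (max |a| |b| ^ (p / 2 - 1)) ^ 2 * (a - b) ^ 2 := by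
        rw [mul_pow, mul_pow, sq_abs]
    _ ≤ _ := by gcongr

end SignedPower

section Poincare

variable {α : Type*} [Fintype α] {n : ℕ}

/-- The squared discrete gradient of `h` in the coordinate `j`, with neighbours `u` and `d`. -/
def sqGrad {α : Type*} {n : ℕ} (u d : α → α) (h : (Fin n → α) → ℝ) (j : Fin n)
    (w : Fin n → α) : ℝ :=
  (h (Function.update w j (u (w j))) - h w) ^ 2 + (h (Function.update w j (d (w j))) - h w) ^ 2

lemma sqGrad_nonneg {α : Type*} {n : ℕ} (u d : α → α) (h : (Fin n → α) → ℝ) (j : Fin n)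
    (w : Fin n → α) :
    0 ≤ sqGrad u d h j w := by
  unfold sqGrad; positivity

lemma exists_pexp_spow_eq_zero {κ : Fin n → α → ℝ} (hκ : IsProbWeight κ) {s : ℝ} (hs : 1 ≤ s)
    (h : (Fin n → α) → ℝ) : ∃ c, pexp κ (fun w => spow s (h w - c)) = 0 := by
  have hs0 : 0 < s := by linarith
  have hcont : Continuous fun c => pexp κ (fun w => spow s (h w - c)) := by
    unfold pexp
    refine continuous_finsetSum _ fun w _ => continuous_const.mul ?_
    exact (continuous_spow hs).comp (continuous_const.sub continuous_id)
  have hM : ∀ w, |h w| ≤ ∑ v, |h v| := fun w =>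
    single_le_sum (f := fun v => |h v|) (fun _ _ => abs_nonneg _) (mem_univ w)
  refine mem_range_of_exists_le_of_exists_ge hcont ⟨∑ v, |h v|, ?_⟩ ⟨-∑ v, |h v|, ?_⟩
  · have := pexp_mono hκ (F := fun w => spow s (h w - ∑ v, |h v|)) (G := fun _ => 0) fun w => by
      rw [← neg_sub, spow_neg, spow_of_nonneg hs0 (by linarith [(abs_le.1 (hM w)).2])]
      have : 0 ≤ (∑ v, |h v| - h w) ^ s :=
        Real.rpow_nonneg (by linarith [(abs_le.1 (hM w)).2]) _
      linarith
    rwa [pexp_const hκ] at this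
  · refine pexp_nonneg hκ fun w => ?_
    rw [spow_of_nonneg hs0 (by linarith [(abs_le.1 (hM w)).1])]
    exact Real.rpow_nonneg (by linarith [(abs_le.1 (hM w)).1]) _

lemma rpow_mul_le_young {p : ℝ} (hp : 2 < p) {x y : ℝ} (hx : 0 ≤ x) (hy : 0 ≤ y) :
    x ^ (p - 2) * y ≤ (1 - 2 / p) * x ^ p + 2 / p * y ^ (p / 2) := by
  have hp0 : 0 < p := by linarith
  have hp2 : 0 < p - 2 := by linarith
  have hc : (p / (p - 2)).HolderConjugate (p / 2) := by
    rw [Real.holderConjugate_iff]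
    refine ⟨?_, ?_⟩
    · rw [lt_div_iff₀ hp2]; linarith
    · field_simp; ring
  have := Real.young_inequality_of_nonneg (Real.rpow_nonneg hx (p - 2)) hy hc
  rw [← Real.rpow_mul hx, mul_div_cancel₀ _ hp2.ne'] at this
  refine this.trans (le_of_eq ?_)
  field_simp

/-- The Poincaré inequality in `L_p` for a product measure. -/
lemma lp_poincare {κ : Fin n → α → ℝ} (hκ : IsProbWeight κ) {p : ℝ} (hp : 2 < p)
    (u d : α → α) {B : Fin n → ℝ} (hB : ∀ j, 0 ≤ B j)
    (H : ∀ j (φ : α → ℝ), wvar (κ j) (fun a => spow (p / 2) (φ a)) ≤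
      B j * ∑ a, κ j a * (|φ a| ^ (p - 2) * ((φ (u a) - φ a) ^ 2 + (φ (d a) - φ a) ^ 2)))
    (h : (Fin n → α) → ℝ) :
    ∃ c, pexp κ (fun w => |h w - c| ^ p) ≤
      pexp κ (fun w => (∑ j, B j * sqGrad u d h j w) ^ (p / 2)) := by
  obtain ⟨c, hc⟩ := exists_pexp_spow_eq_zero hκ (s := p / 2) (by linarith) h
  refine ⟨c, ?_⟩
  have hes := efron_stein hκ (fun w => spow (p / 2) (h w - c))
  rw [hc] at hes
  simp only [spow_sq hp.le] at hes
  have h1 : ∀ j, pexp κ (fun w => wvar (κ j)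
      (fun a => spow (p / 2) (h (Function.update w j a) - c))) ≤
      pexp κ (fun w => |h w - c| ^ (p - 2) * (B j * sqGrad u d h j w)) := by
    intro j
    rw [← pexp_resample hκ j (fun w => |h w - c| ^ (p - 2) * (B j * sqGrad u d h j w))]
    refine pexp_mono hκ fun w => (H j _).trans (le_of_eq ?_)
    rw [mul_sum]
    refine sum_congr rfl fun a _ => ?_
    simp only [sqGrad, Function.update_self, Function.update_idem]
    ring
  have h2 := hes.trans (sum_le_sum fun j _ => h1 j)
  rw [← pexp_sum] at h2
  have hG : ∀ w, 0 ≤ ∑ j, B j * sqGrad u d h j w := fun w =>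
    sum_nonneg fun j _ => mul_nonneg (hB j) (sqGrad_nonneg _ _ _ _ _)
  have h3 : pexp κ (fun w => ∑ j, |h w - c| ^ (p - 2) * (B j * sqGrad u d h j w)) ≤
      pexp κ (fun w => (1 - 2 / p) * |h w - c| ^ p +
        2 / p * (∑ j, B j * sqGrad u d h j w) ^ (p / 2)) := by
    refine pexp_mono hκ fun w => ?_
    rw [← mul_sum]
    exact rpow_mul_le_young hp (abs_nonneg _) (hG w)
  rw [pexp_add, pexp_const_mul, pexp_const_mul] at h3
  have hp0 : 0 < 2 / p := by positivity
  have h4 : 2 / p * pexp κ (fun w => |h w - c| ^ p) ≤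
      2 / p * pexp κ (fun w => (∑ j, B j * sqGrad u d h j w) ^ (p / 2)) := by
    norm_num at h2
    linarith
  exact le_of_mul_le_mul_left h4 hp0

lemma abs_sub_rpow_le {p : ℝ} (hp : 1 ≤ p) (x y c : ℝ) :
    |x - y| ^ p ≤ 2 ^ (p - 1) * (|x - c| ^ p + |y - c| ^ p) := by
  have hadd : (|x - c| + |y - c|) ^ p ≤ 2 ^ (p - 1) * (|x - c| ^ p + |y - c| ^ p) := by
    have := NNReal.rpow_add_le_mul_rpow_add_rpow ‖x - c‖₊ ‖y - c‖₊ hp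
    have := NNReal.coe_le_coe.2 this
    push_cast at this
    simpa only [Real.norm_eq_abs] using this
  refine le_trans ?_ hadd
  refine Real.rpow_le_rpow (abs_nonneg _) ?_ (by linarith)
  have := abs_sub_le x c y
  rwa [abs_sub_comm c y] at this

/-- The Poincaré inequality in `L_p` for the difference of two independent samples. -/
lemma lp_poincare_pair {κ : Fin n → α → ℝ} (hκ : IsProbWeight κ) {p : ℝ} (hp : 2 < p)
    (u d : α → α) {B : Fin n → ℝ} (hB : ∀ j, 0 ≤ B j)
    (H : ∀ j (φ : α → ℝ), wvar (κ j) (fun a => spow (p / 2) (φ a)) ≤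
      B j * ∑ a, κ j a * (|φ a| ^ (p - 2) * ((φ (u a) - φ a) ^ 2 + (φ (d a) - φ a) ^ 2)))
    (h : (Fin n → α) → ℝ) :
    pexp κ (fun w => pexp κ (fun v => |h w - h v| ^ p)) ≤
      2 ^ p * pexp κ (fun w => (∑ j, B j * sqGrad u d h j w) ^ (p / 2)) := by
  obtain ⟨c, hc⟩ := lp_poincare hκ hp u d hB H h
  have h1 : pexp κ (fun w => pexp κ (fun v => |h w - h v| ^ p)) ≤
      pexp κ (fun w => pexp κ (fun v => 2 ^ (p - 1) * (|h w - c| ^ p + |h v - c| ^ p))) :=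
    pexp_mono hκ fun w => pexp_mono hκ fun v => abs_sub_rpow_le (by linarith) _ _ _
  simp only [pexp_const_mul, pexp_add, pexp_const hκ] at h1
  have h2 : (2 : ℝ) ^ p = 2 ^ (p - 1) * 2 := by
    rw [← Real.rpow_add_one (by norm_num)]; congr 1; ring
  rw [h2]
  have h3 : (0 : ℝ) < 2 ^ (p - 1) := by positivity
  nlinarith

end Poincare

section Selectors

variable {n : ℕ}

/-- Bernoulli weights of parameter `δ`. -/
noncomputable def bern (n : ℕ) (δ : ℝ) : Fin n → Bool → ℝ := fun _ b => if b then δ else 1 - δ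

lemma isProbWeight_bern {δ : ℝ} (h0 : 0 ≤ δ) (h1 : δ ≤ 1) : IsProbWeight (bern n δ) := by
  refine ⟨fun j a => ?_, fun j => ?_⟩
  · cases a <;> simp [bern, h0, h1]
  · simp [bern]

/-- The indicator of `true`. -/
def ind (b : Bool) : ℝ := if b then 1 else 0

lemma ind_nonneg (b : Bool) : 0 ≤ ind b := by cases b <;> simp [ind]

lemma rpow_pred_mul_le_young {s : ℝ} (hs : 1 < s) {x y : ℝ} (hx : 0 ≤ x) (hy : 0 ≤ y) :
    x ^ (s - 1) * y ≤ (1 - 1 / s) * x ^ s + 1 / s * y ^ s := by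
  have hp := rpow_mul_le_young (p := 2 * s) (by linarith) (Real.sqrt_nonneg x) hy
  have e : ∀ t : ℝ, Real.sqrt x ^ (2 * t) = x ^ t := by
    intro t
    rw [Real.sqrt_eq_rpow, ← Real.rpow_mul hx]; congr 1; ring
  have e1 : 2 * s - 2 = 2 * (s - 1) := by ring
  have e2 : 2 / (2 * s) = 1 / s := by field_simp
  have e3 : 2 * s / 2 = s := by ring
  rwa [e1, e, e, e2, e3] at hp

lemma pow_split {s : ℝ} (hs : 1 < s) {x y : ℝ} (hx : 0 ≤ x) (hy : 0 ≤ y) :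
    (x + y) ^ (s - 1) ≤ 2 ^ (s - 1) * (x ^ (s - 1) + y ^ (s - 1)) := by
  have hs' : 0 ≤ s - 1 := by linarith
  have h1 : (x + y) ^ (s - 1) ≤ (2 * max x y) ^ (s - 1) := by
    refine Real.rpow_le_rpow (by positivity) ?_ hs'
    linarith [le_max_left x y, le_max_right x y]
  rw [Real.mul_rpow (by norm_num) (by positivity)] at h1
  refine h1.trans (mul_le_mul_of_nonneg_left ?_ (by positivity))
  have := Real.rpow_nonneg hx (s - 1)
  have := Real.rpow_nonneg hy (s - 1)
  rcases le_total x y with h | h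
  · rw [max_eq_right h]; linarith
  · rw [max_eq_left h]; linarith

/-- Rosenthal's inequality for sums of nonnegative selectors. -/
lemma rosenthal_selectors {s : ℝ} (hs : 1 < s) {δ : ℝ} (h0 : 0 ≤ δ) (h1 : δ ≤ 1)
    (a : Fin n → ℝ) (ha : ∀ j, 0 ≤ a j) :
    pexp (bern n δ) (fun χ => (∑ j, ind (χ j) * a j) ^ s) ≤
      s * 2 ^ (s - 1) * (δ * ∑ j, a j ^ s) + (2 ^ (s - 1) * (δ * ∑ j, a j)) ^ s := by
  have hκ := isProbWeight_bern (n := n) h0 h1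
  have hs' : 0 ≤ s - 1 := by linarith
  set A : ℝ := 2 ^ (s - 1) with hA
  have hA0 : 0 < A := by positivity
  let X : (Fin n → Bool) → ℝ := fun χ => ∑ j, ind (χ j) * a j
  have hX : ∀ χ, 0 ≤ X χ := fun χ => sum_nonneg fun j _ => mul_nonneg (ind_nonneg _) (ha j)
  let Y : Fin n → (Fin n → Bool) → ℝ := fun j χ => ∑ i ∈ univ.erase j, ind (χ i) * a i
  have hY : ∀ j χ, 0 ≤ Y j χ := fun j χ =>
    sum_nonneg fun j _ => mul_nonneg (ind_nonneg _) (ha j)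
  have hXY : ∀ j χ, X χ = ind (χ j) * a j + Y j χ := fun j χ =>
    (add_sum_erase univ (fun i => ind (χ i) * a i) (mem_univ j)).symm
  have hYX : ∀ j χ, Y j χ ≤ X χ := fun j χ => by
    rw [hXY j]; linarith [mul_nonneg (ind_nonneg (χ j)) (ha j)]
  have hXs : ∀ χ, X χ ^ s = ∑ j, ind (χ j) * (a j * X χ ^ (s - 1)) := by
    intro χ
    have : X χ ^ s = X χ * X χ ^ (s - 1) := by
      rcases (hX χ).eq_or_lt with h | h
      · rw [← h, Real.zero_rpow (by linarith), zero_mul]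
      · rw [mul_comm, ← Real.rpow_add_one h.ne']; congr 1; ring
    rw [this]
    simp only [X, sum_mul]
    exact sum_congr rfl fun j _ => by ring
  have hterm : ∀ j, pexp (bern n δ) (fun χ => ind (χ j) * (a j * X χ ^ (s - 1))) ≤
      δ * (A * a j ^ s) + δ * (A * a j) * pexp (bern n δ) (fun χ => X χ ^ (s - 1)) := by
    intro j
    have e1 : pexp (bern n δ) (fun χ => ind (χ j) * (a j * X χ ^ (s - 1))) ≤
        pexp (bern n δ) (fun χ => ind (χ j) * (A * a j ^ s + A * a j * Y j χ ^ (s - 1))) := by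
      refine pexp_mono hκ fun χ => ?_
      rcases hb : χ j with _ | _
      · simp [ind]
      · rw [hXY j, hb]
        simp only [ind, if_true, one_mul]
        have h2 := mul_le_mul_of_nonneg_left (pow_split hs (ha j) (hY j χ)) (ha j)
        have h3 : a j ^ s = a j * a j ^ (s - 1) := by
          rcases (ha j).eq_or_lt with h | h
          · rw [← h, Real.zero_rpow (by linarith), zero_mul]
          · rw [mul_comm, ← Real.rpow_add_one h.ne']; congr 1; ring
        rw [h3]
        refine h2.trans (le_of_eq ?_)
        ring
    refine e1.trans ?_
    rw [pexp_mul_of_update hκ j ind]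
    · have : ∑ b, bern n δ j b * ind b = δ := by simp [bern, ind]
      rw [this, pexp_add, pexp_const hκ, pexp_const_mul, mul_add, mul_assoc δ]
      gcongr
      · exact mul_nonneg hA0.le (ha j)
      · exact pexp_mono hκ fun χ => Real.rpow_le_rpow (hY j χ) (hYX j χ) hs'
    · intro χ b
      congr 3
      refine sum_congr rfl fun i hi => ?_
      rw [Function.update_of_ne (ne_of_mem_erase hi)]
  have hmain : pexp (bern n δ) (fun χ => X χ ^ s) ≤ A * (δ * ∑ j, a j ^ s) +
      pexp (bern n δ) (fun χ => X χ ^ (s - 1) * (A * (δ * ∑ j, a j))) := by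
    have e2 : pexp (bern n δ) (fun χ => X χ ^ (s - 1) * (A * (δ * ∑ j, a j))) =
        (A * (δ * ∑ j, a j)) * pexp (bern n δ) (fun χ => X χ ^ (s - 1)) := by
      rw [← pexp_const_mul]; congr 1; funext χ; ring
    rw [e2]
    calc pexp (bern n δ) (fun χ => X χ ^ s)
        = ∑ j, pexp (bern n δ) (fun χ => ind (χ j) * (a j * X χ ^ (s - 1))) := by
          rw [← pexp_sum]; congr 1; funext χ; exact hXs χ
      _ ≤ _ := sum_le_sum fun j _ => hterm j
      _ = _ := by
          rw [sum_add_distrib, ← sum_mul, ← mul_sum, ← mul_sum, ← mul_sum, ← mul_sum]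
          ring
  have hyoung : pexp (bern n δ) (fun χ => X χ ^ (s - 1) * (A * (δ * ∑ j, a j))) ≤
      (1 - 1 / s) * pexp (bern n δ) (fun χ => X χ ^ s) + 1 / s * (A * (δ * ∑ j, a j)) ^ s := by
    rw [← pexp_const_mul, ← pexp_const hκ (1 / s * (A * (δ * ∑ j, a j)) ^ s), ← pexp_add]
    refine pexp_mono hκ fun χ => ?_
    exact rpow_pred_mul_le_young hs (hX χ)
      (mul_nonneg hA0.le (mul_nonneg h0 (sum_nonneg fun j _ => ha j)))
  have hs0 : 0 < s := by linarith
  have hfin : 1 / s * pexp (bern n δ) (fun χ => X χ ^ s) ≤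
      A * (δ * ∑ j, a j ^ s) + 1 / s * (A * (δ * ∑ j, a j)) ^ s := by linarith
  have := mul_le_mul_of_nonneg_left hfin hs0.le
  have e3 : ∀ x, s * (1 / s * x) = x := fun x => by field_simp
  rw [mul_add, e3, e3, ← mul_assoc s] at this
  exact this

end Selectors

section Path

variable {m : ℕ}

/-- The upper neighbour in the path `Fin m` (the top element is fixed). -/
def upNbr (a : Fin m) : Fin m := ⟨min (a + 1) (m - 1), by have := a.2; omega⟩

/-- The lower neighbour in the path `Fin m` (the bottom element is fixed). -/
def downNbr (a : Fin m) : Fin m := ⟨a - 1, by have := a.2; omega⟩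

/-- The distance in the path `Fin m`. -/
def pathDist (a b : Fin m) : ℕ := ((a : ℤ) - (b : ℤ)).natAbs

lemma cast_pathDist (a b : Fin m) : (pathDist a b : ℝ) = |((a : ℕ) : ℝ) - ((b : ℕ) : ℝ)| := by
  rw [pathDist, Nat.cast_natAbs]
  push_cast
  rfl

lemma abs_sub_le_sum_upNbr (g : Fin m → ℝ) (a b : Fin m) :
    |g a - g b| ≤ ∑ c, |g (upNbr c) - g c| := by
  have hm : 0 < m := a.pos
  let G : ℕ → ℝ := fun i => g ⟨min i (m - 1), by omega⟩
  have hG : ∀ c : Fin m, G c = g c := fun c => by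
    simp only [G]; congr 1; ext; simp only []; have := c.2; omega
  have hG' : ∀ c : Fin m, G (c + 1) = g (upNbr c) := fun c => rfl
  have key : ∀ a b : Fin m, a ≤ b → |g a - g b| ≤ ∑ c, |g (upNbr c) - g c| := by
    intro a b hab
    have h1 := dist_le_Ico_sum_dist G (show (a : ℕ) ≤ b from hab)
    rw [Real.dist_eq, hG, hG] at h1
    refine h1.trans ?_
    have h2 : ∑ c : Fin m, |g (upNbr c) - g c| = ∑ i ∈ range m, dist (G i) (G (i + 1)) := by
      rw [Finset.sum_range]
      refine sum_congr rfl fun c _ => ?_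
      rw [hG, hG', Real.dist_eq, abs_sub_comm]
    rw [h2]
    refine sum_le_sum_of_subset_of_nonneg ?_ fun _ _ _ => dist_nonneg
    intro i hi
    rw [mem_Ico] at hi
    rw [mem_range]
    have := b.2
    omega
  rcases le_total a b with h | h
  · exact key a b h
  · rw [abs_sub_comm]; exact key b a h

lemma wvar_uniform_le (hm : 0 < m) (g : Fin m → ℝ) :
    wvar (fun _ : Fin m => 1 / (m : ℝ)) g ≤
      (m : ℝ) ^ 2 * ∑ a, 1 / (m : ℝ) * (g (upNbr a) - g a) ^ 2 := by
  have hm' : (0 : ℝ) < m := by exact_mod_cast hm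
  have h1 : ∑ _a : Fin m, 1 / (m : ℝ) = 1 := by
    simp [hm'.ne']
  have h2 : ∀ a b, (g a - g b) ^ 2 ≤ m * ∑ c, (g (upNbr c) - g c) ^ 2 := by
    intro a b
    calc (g a - g b) ^ 2 = |g a - g b| ^ 2 := (sq_abs _).symm
      _ ≤ (∑ c, |g (upNbr c) - g c|) ^ 2 := by
          gcongr; exact abs_sub_le_sum_upNbr g a b
      _ ≤ m * ∑ c, (g (upNbr c) - g c) ^ 2 := by
          have := sq_sum_le_card_mul_sum_sq (s := univ) (f := fun c => |g (upNbr c) - g c|)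
          simpa only [card_univ, Fintype.card_fin, sq_abs] using this
  rw [wvar_eq_sum_sum h1]
  have h3 : ∑ a : Fin m, ∑ b : Fin m, 1 / (m : ℝ) * (1 / m) * (g a - g b) ^ 2 ≤
      ∑ a : Fin m, ∑ b : Fin m, 1 / (m : ℝ) * (1 / m) * (m * ∑ c, (g (upNbr c) - g c) ^ 2) :=
    sum_le_sum fun a _ => sum_le_sum fun b _ => mul_le_mul_of_nonneg_left (h2 a b) (by positivity)
  have h4 : ∑ a : Fin m, ∑ b : Fin m, 1 / (m : ℝ) * (1 / m) *
      (m * ∑ c, (g (upNbr c) - g c) ^ 2) = m * ∑ c, (g (upNbr c) - g c) ^ 2 := by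
    simp only [sum_const, card_univ, Fintype.card_fin, nsmul_eq_mul]
    field_simp
  have h5 : (m : ℝ) ^ 2 * ∑ a, 1 / (m : ℝ) * (g (upNbr a) - g a) ^ 2 =
      m * ∑ c, (g (upNbr c) - g c) ^ 2 := by
    rw [← mul_sum]; field_simp
  have h6 : (0 : ℝ) ≤ m * ∑ c, (g (upNbr c) - g c) ^ 2 := by positivity
  rw [h5]
  linarith

lemma sum_upNbr_le (ψ : Fin m → Fin m → ℝ) (h0 : ∀ a b, 0 ≤ ψ a b) (hd : ∀ a, ψ a a = 0) :
    ∑ a, ψ (upNbr a) a ≤ ∑ b, ψ b (downNbr b) := by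
  have h1 : ∑ a, ψ (upNbr a) a = ∑ a ∈ univ.filter (fun a : Fin m => (a : ℕ) + 1 < m),
      ψ (upNbr a) (downNbr (upNbr a)) := by
    rw [sum_filter]
    refine sum_congr rfl fun a _ => ?_
    split_ifs with h
    · congr 1
      ext
      simp only [upNbr, downNbr]
      omega
    · have : upNbr a = a := by
        ext; simp only [upNbr]; have := a.2; omega
      rw [this, hd]
  rw [h1, ← sum_image (f := fun b => ψ b (downNbr b)) (g := upNbr)]
  · exact sum_le_sum_of_subset_of_nonneg (subset_univ _) fun _ _ _ => h0 _ _
  · intro a ha b hb hab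
    simp only [coe_filter, mem_univ, true_and, Set.mem_ofPred_eq] at ha hb
    have := congrArg Fin.val hab
    simp only [upNbr] at this
    ext
    omega

lemma wvar_uniform_spow_le (hm : 0 < m) {p : ℝ} (hp : 2 ≤ p) (φ : Fin m → ℝ) :
    wvar (fun _ : Fin m => 1 / (m : ℝ)) (fun a => spow (p / 2) (φ a)) ≤
      (p * m) ^ 2 * ∑ a, 1 / (m : ℝ) * (|φ a| ^ (p - 2) *
        ((φ (upNbr a) - φ a) ^ 2 + (φ (downNbr a) - φ a) ^ 2)) := by
  have hm' : (0 : ℝ) < m := by exact_mod_cast hm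
  have h1 := wvar_uniform_le hm (fun a => spow (p / 2) (φ a))
  rw [← mul_sum] at h1 ⊢
  have h2 : ∑ a, (spow (p / 2) (φ (upNbr a)) - spow (p / 2) (φ a)) ^ 2 ≤
      ∑ a, (p / 2) ^ 2 * (|φ (upNbr a)| ^ (p - 2) * (φ (upNbr a) - φ a) ^ 2) +
      ∑ a, (p / 2) ^ 2 * (|φ a| ^ (p - 2) * (φ (upNbr a) - φ a) ^ 2) := by
    rw [← sum_add_distrib]
    refine sum_le_sum fun a _ => (abs_spow_sub_sq_le hp _ _).trans (le_of_eq (by ring))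
  have h3 := sum_upNbr_le (fun b a => |φ b| ^ (p - 2) * (φ b - φ a) ^ 2)
    (fun a b => by positivity) (fun a => by simp)
  rw [← mul_sum, ← mul_sum, ← mul_add] at h2
  have h4 : ∑ a, |φ (upNbr a)| ^ (p - 2) * (φ (upNbr a) - φ a) ^ 2 +
      ∑ a, |φ a| ^ (p - 2) * (φ (upNbr a) - φ a) ^ 2 ≤
      ∑ a, |φ a| ^ (p - 2) * ((φ (upNbr a) - φ a) ^ 2 + (φ (downNbr a) - φ a) ^ 2) := by
    simp only [mul_add, sum_add_distrib]
    have : ∀ a, |φ a| ^ (p - 2) * (φ (downNbr a) - φ a) ^ 2 =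
      |φ a| ^ (p - 2) * (φ a - φ (downNbr a)) ^ 2 := fun a => by ring
    simp only [this]
    linarith
  have h0 : 0 ≤ ∑ a, |φ a| ^ (p - 2) * ((φ (upNbr a) - φ a) ^ 2 + (φ (downNbr a) - φ a) ^ 2) :=
    sum_nonneg fun a _ => by positivity
  set T := ∑ a, |φ a| ^ (p - 2) * ((φ (upNbr a) - φ a) ^ 2 + (φ (downNbr a) - φ a) ^ 2)
  calc _ ≤ _ := h1
    _ ≤ (m : ℝ) ^ 2 * (1 / m * ((p / 2) ^ 2 * T)) := by
        gcongr
        exact h2.trans (mul_le_mul_of_nonneg_left h4 (by positivity))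
    _ ≤ (m : ℝ) ^ 2 * (1 / m * (p ^ 2 * T)) := by
        gcongr
        linarith
    _ = _ := by ring

lemma wvar_single {α : Type*} [Fintype α] [DecidableEq α] (y : α) (φ : α → ℝ) :
    wvar (Pi.single y 1) φ = 0 := by
  simp [wvar, Pi.single_apply]

lemma sum_pathDist_le (φ : ℕ → ℝ) (h0 : ∀ d, 0 ≤ φ d) (hs : Summable φ) (a : Fin m) :
    ∑ b, φ (pathDist a b) ≤ 2 * ∑' d, φ d := by
  have key : ∀ s : Finset (Fin m), Set.InjOn (pathDist a) s →
      ∑ b ∈ s, φ (pathDist a b) ≤ ∑' d, φ d := by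
    intro s hinj
    rw [← sum_image (f := φ) hinj]
    exact hs.sum_le_tsum _ fun _ _ => h0 _
  rw [← sum_filter_add_sum_filter_not univ (fun b => a ≤ b), two_mul]
  refine add_le_add (key _ ?_) (key _ ?_)
  · intro b hb c hc hbc
    simp only [coe_filter, mem_univ, true_and, Set.mem_ofPred_eq, Fin.le_def] at hb hc
    simp only [pathDist] at hbc
    ext; omega
  · intro b hb c hc hbc
    simp only [coe_filter, mem_univ, true_and, Set.mem_ofPred_eq, Fin.le_def] at hb hc
    simp only [pathDist] at hbc
    ext; omega

/-- The normalizing factor of the geometric kernel. -/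
noncomputable def geomMass (a : Fin m) : ℝ := ∑ b, (1 / 2 : ℝ) ^ pathDist a b

/-- The geometric smoothing kernel on the path. -/
noncomputable def geomKernel (a b : Fin m) : ℝ := (1 / 2 : ℝ) ^ pathDist a b / geomMass a

lemma one_le_geomMass (a : Fin m) : 1 ≤ geomMass a := by
  have : (1 / 2 : ℝ) ^ pathDist a a ≤ geomMass a :=
    single_le_sum (f := fun b => (1 / 2 : ℝ) ^ pathDist a b) (fun _ _ => by positivity)
      (mem_univ a)
  simpa [pathDist] using this

lemma geomKernel_pos (a b : Fin m) : 0 < geomKernel a b := by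
  have := one_le_geomMass a
  unfold geomKernel
  positivity

lemma sum_geomKernel (a : Fin m) : ∑ b, geomKernel a b = 1 := by
  have := one_le_geomMass a
  unfold geomKernel
  rw [← sum_div]
  exact div_self (zero_lt_one.trans_le this).ne'

/-- The kernels at neighbouring points have a bounded ratio. -/
lemma geomKernel_le {a a' : Fin m} (h : pathDist a a' ≤ 1) (b : Fin m) :
    geomKernel a' b ≤ 4 * geomKernel a b := by
  have key : ∀ {a a' : Fin m}, pathDist a a' ≤ 1 → ∀ b : Fin m,
      (1 / 2 : ℝ) ^ pathDist a' b ≤ 2 * (1 / 2 : ℝ) ^ pathDist a b := by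
    intro a a' h b
    have h1 : pathDist a b ≤ pathDist a' b + 1 := by
      simp only [pathDist] at h ⊢; omega
    have h2 := pow_le_pow_of_le_one (by norm_num : (0 : ℝ) ≤ 1 / 2) (by norm_num) h1
    rw [pow_succ] at h2
    linarith
  have h' : pathDist a' a ≤ 1 := by
    simp only [pathDist] at h ⊢; omega
  have hZ : geomMass a ≤ 2 * geomMass a' := by
    unfold geomMass
    rw [mul_sum]
    exact sum_le_sum fun b _ => key h' b
  have h1 := one_le_geomMass a
  have h2 := one_le_geomMass a'
  unfold geomKernel
  rw [← mul_div_assoc, div_le_div_iff₀ (by linarith) (by linarith)]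
  calc (1 / 2 : ℝ) ^ pathDist a' b * geomMass a
      ≤ (2 * (1 / 2 : ℝ) ^ pathDist a b) * (2 * geomMass a') := by
        gcongr
        exact key h b
    _ = _ := by ring

/-- The geometric kernel has bounded moments. -/
lemma exists_geomKernel_moment {r : ℝ} (hr : 0 < r) :
    ∃ M : ℝ, 0 < M ∧ ∀ (m : ℕ) (a : Fin m),
      ∑ b, geomKernel a b * (pathDist a b : ℝ) ^ r ≤ M := by
  let φ : ℕ → ℝ := fun d => (1 / 2 : ℝ) ^ d * (d : ℝ) ^ r
  have hφ : ∀ d, 0 ≤ φ d := fun d => by positivity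
  have hs : Summable φ := by
    have h1 := summable_pow_mul_geometric_of_norm_lt_one (R := ℝ) ⌈r⌉₊ (r := 1 / 2)
      (by norm_num)
    refine Summable.of_nonneg_of_le hφ (fun d => ?_) h1
    rw [mul_comm ((d : ℝ) ^ ⌈r⌉₊)]
    refine mul_le_mul_of_nonneg_left ?_ (by positivity)
    rcases Nat.eq_zero_or_pos d with rfl | hd
    · simp [Real.zero_rpow hr.ne']
    · rw [← Real.rpow_natCast]
      exact Real.rpow_le_rpow_of_exponent_le (by exact_mod_cast hd) (Nat.le_ceil r)
  refine ⟨2 * ∑' d, φ d + 1, by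
    have : 0 ≤ ∑' d, φ d := tsum_nonneg hφ
    linarith, fun m a => ?_⟩
  have h2 := sum_pathDist_le φ hφ hs a
  have h3 : ∑ b, geomKernel a b * (pathDist a b : ℝ) ^ r ≤ ∑ b, φ (pathDist a b) := by
    refine sum_le_sum fun b _ => mul_le_mul_of_nonneg_right ?_ (by positivity)
    exact div_le_self (by positivity) (one_le_geomMass a)
  linarith

lemma le_sum_pathDist (hm : 2 ≤ m) (b : Fin m) : (m : ℝ) ^ 2 / 9 ≤ ∑ a, (pathDist a b : ℝ) := by
  have h1 : (m / 2) * (m / 2) ≤ ∑ a, pathDist a b := by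
    let φ : ℕ → ℕ := fun i => ((i : ℤ) - (b : ℤ)).natAbs
    have h2 : ∑ a, pathDist a b = ∑ i ∈ range m, φ i := by
      rw [Finset.sum_range]; rfl
    have h3 : ∑ i ∈ range (m / 2 + m / 2), φ i ≤ ∑ i ∈ range m, φ i :=
      sum_le_sum_of_subset (range_subset_range.2 (by omega))
    rw [sum_range_add, ← sum_add_distrib] at h3
    have h4 : ∑ _i ∈ range (m / 2), (m / 2) ≤
        ∑ i ∈ range (m / 2), (φ i + φ (m / 2 + i)) := by
      refine sum_le_sum fun i _ => ?_
      simp only [φ]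
      omega
    rw [sum_const, card_range, smul_eq_mul] at h4
    omega
  have h5 : (m : ℝ) ≤ 3 * ((m / 2 : ℕ) : ℝ) := by
    have : m ≤ 3 * (m / 2) := by omega
    exact_mod_cast this
  have h6 : (((m / 2 : ℕ) : ℝ)) * ((m / 2 : ℕ) : ℝ) ≤ ∑ a, (pathDist a b : ℝ) := by
    exact_mod_cast h1
  nlinarith [(Nat.cast_nonneg m : (0 : ℝ) ≤ m)]

/-- The mean `q`-th power of the distance in the path is of order `m ^ q`. -/
lemma le_mean_pathDist_rpow (hm : 2 ≤ m) {q : ℝ} (hq : 1 ≤ q) (b : Fin m) :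
    ((m : ℝ) / 9) ^ q ≤ ∑ a, 1 / (m : ℝ) * (pathDist a b : ℝ) ^ q := by
  have hm' : (0 : ℝ) < m := by exact_mod_cast (by omega : 0 < m)
  have h1 := Real.rpow_arith_mean_le_arith_mean_rpow (univ : Finset (Fin m))
    (fun _ => 1 / (m : ℝ)) (fun a => (pathDist a b : ℝ)) (fun _ _ => by positivity)
    (by simp [hm'.ne']) (fun _ _ => by positivity) hq
  refine le_trans (Real.rpow_le_rpow (by positivity) ?_ (by linarith)) h1
  rw [← mul_sum]
  have := le_sum_pathDist hm b
  rw [div_mul_eq_mul_div, one_mul, le_div_iff₀ hm']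
  nlinarith

end Path

section GridInequality

variable {n m : ℕ}

/-- The weights of the geometric smoothing around the grid point `x`. -/
noncomputable def gridKernel (x : Fin n → Fin m) : Fin n → Fin m → ℝ := fun j => geomKernel (x j)

/-- The uniform weights on the grid. -/
noncomputable def unifWeight (n m : ℕ) : Fin n → Fin m → ℝ := fun _ _ => 1 / (m : ℝ)

/-- The weights which resample uniformly the coordinates `j` of `y` such that `χ j = true`. -/
noncomputable def resampleWeight (χ : Fin n → Bool) (y : Fin n → Fin m) : Fin n → Fin m → ℝ :=
  fun j => if χ j then fun _ => 1 / (m : ℝ) else Pi.single (y j) 1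

/-- The smoothing of `u` at scale `1`. -/
noncomputable def smoothing (u : (Fin n → Fin m) → ℝ) (x : Fin n → Fin m) : ℝ :=
  pexp (gridKernel x) u

lemma isProbWeight_gridKernel (x : Fin n → Fin m) : IsProbWeight (gridKernel x) :=
  ⟨fun _ _ => (geomKernel_pos _ _).le, fun _ => sum_geomKernel _⟩

lemma isProbWeight_unifWeight (hm : 0 < m) : IsProbWeight (unifWeight n m) := by
  have hm' : (m : ℝ) ≠ 0 := by exact_mod_cast hm.ne'
  refine ⟨fun _ _ => ?_, fun _ => ?_⟩
  · unfold unifWeight; positivity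
  · simp [unifWeight, hm']

lemma isProbWeight_resampleWeight (hm : 0 < m) (χ : Fin n → Bool) (y : Fin n → Fin m) :
    IsProbWeight (resampleWeight χ y) := by
  have hm' : (m : ℝ) ≠ 0 := by exact_mod_cast hm.ne'
  refine ⟨fun j a => ?_, fun j => ?_⟩
  · unfold resampleWeight
    split_ifs
    · positivity
    · rw [Pi.single_apply]; split_ifs <;> norm_num
  · unfold resampleWeight
    split_ifs
    · simp [hm']
    · simp

lemma pexp_unif_resample (hm : 0 < m) (χ : Fin n → Bool) (F : (Fin n → Fin m) → ℝ) :
    pexp (unifWeight n m) (fun y => pexp (resampleWeight χ y) F) = pexp (unifWeight n m) F := by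
  have hm' : (m : ℝ) ≠ 0 := by exact_mod_cast hm.ne'
  have := pexp_pexp (unifWeight n m)
    (fun j a => if χ j then fun _ => 1 / (m : ℝ) else Pi.single a 1) F
  unfold resampleWeight
  rw [this]
  congr 1
  funext j b
  rcases χ j with _ | _
  · simp [unifWeight, Pi.single_apply]
  · simp [unifWeight, hm']

/-- The relative change of the kernel when its centre moves. -/
noncomputable def score (a a' b : Fin m) : ℝ := geomKernel a' b / geomKernel a b - 1

lemma sum_geomKernel_mul_score (a a' : Fin m) : ∑ b, geomKernel a b * score a a' b = 0 := by
  have : ∀ b, geomKernel a b * score a a' b = geomKernel a' b - geomKernel a b := fun b => by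
    have := (geomKernel_pos a b).ne'
    unfold score
    field_simp
  simp only [this, sum_sub_distrib, sum_geomKernel, sub_self]

lemma abs_score_le {a a' : Fin m} (h : pathDist a a' ≤ 1) (b : Fin m) : |score a a' b| ≤ 3 := by
  have h1 : geomKernel a' b / geomKernel a b ≤ 4 := by
    rw [div_le_iff₀ (geomKernel_pos a b)]
    exact geomKernel_le h b
  have h2 : 0 < geomKernel a' b / geomKernel a b :=
    div_pos (geomKernel_pos _ _) (geomKernel_pos _ _)
  rw [abs_le, score]
  constructor <;> linarith

lemma smoothing_update_sub (u : (Fin n → Fin m) → ℝ) (x : Fin n → Fin m) (j : Fin n)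
    (a' : Fin m) : smoothing u (Function.update x j a') - smoothing u x =
      pexp (gridKernel x) (fun w => score (x j) a' (w j) * u w) := by
  unfold smoothing pexp
  rw [← sum_sub_distrib]
  refine sum_congr rfl fun w _ => ?_
  have h1 : ∏ i, gridKernel (Function.update x j a') i (w i) =
      (∏ i, gridKernel x i (w i)) * (geomKernel a' (w j) / geomKernel (x j) (w j)) := by
    rw [← mul_prod_erase univ _ (mem_univ j),
      ← mul_prod_erase univ (fun i => gridKernel x i (w i)) (mem_univ j)]
    have : ∏ i ∈ univ.erase j, gridKernel (Function.update x j a') i (w i) =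
        ∏ i ∈ univ.erase j, gridKernel x i (w i) :=
      prod_congr rfl fun i hi => by
        simp only [gridKernel]
        rw [Function.update_of_ne (ne_of_mem_erase hi)]
    rw [this]
    simp only [gridKernel, Function.update_self]
    have := (geomKernel_pos (x j) (w j)).ne'
    field_simp
  rw [h1]
  unfold score
  ring

lemma sum_sq_smoothing_le (u : (Fin n → Fin m) → ℝ) (x : Fin n → Fin m) (ν : Fin m → Fin m)
    (hν : ∀ a, pathDist a (ν a) ≤ 1) :
    ∑ j, (smoothing u (Function.update x j (ν (x j))) - smoothing u x) ^ 2 ≤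
      9 * pexp (gridKernel x) (fun w => (u w - u x) ^ 2) := by
  have hκ := isProbWeight_gridKernel x
  have hb := bessel_pexp hκ (fun j => score (x j) (ν (x j)))
    (fun j => sum_geomKernel_mul_score _ _) (B := 9) (by norm_num) (fun j => ?_)
    (fun w => u w - u x)
  · refine le_trans (le_of_eq (sum_congr rfl fun j _ => ?_)) hb
    rw [smoothing_update_sub]
    congr 1
    simp only [mul_sub, pexp_sub]
    rw [pexp_coord hκ j (fun b => score (x j) (ν (x j)) b * u x)]
    have : ∑ a, gridKernel x j a * (score (x j) (ν (x j)) a * u x) = 0 := by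
      simp only [← mul_assoc, ← sum_mul]
      simp only [gridKernel, sum_geomKernel_mul_score, zero_mul]
    rw [this, sub_zero]
  · have h9 : ∀ a, score (x j) (ν (x j)) a ^ 2 ≤ 9 := fun a => by
      have := abs_score_le (hν (x j)) a
      rw [← sq_abs]
      nlinarith [abs_nonneg (score (x j) (ν (x j)) a)]
    calc ∑ a, gridKernel x j a * score (x j) (ν (x j)) a ^ 2 ≤ ∑ a, gridKernel x j a * 9 :=
          sum_le_sum fun a _ => mul_le_mul_of_nonneg_left (h9 a) (hκ.nonneg j a)
      _ = 9 := by rw [← sum_mul, hκ.sum_eq_one, one_mul]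

lemma abs_smoothing_update_rpow_le {p : ℝ} (hp : 1 ≤ p) (u : (Fin n → Fin m) → ℝ)
    (x : Fin n → Fin m) (j : Fin n) {a' : Fin m} (ha' : pathDist (x j) a' ≤ 1) :
    |smoothing u (Function.update x j a') - smoothing u x| ^ p ≤
      3 ^ p * pexp (gridKernel x) (fun w => |u w - u (Function.update w j (x j))| ^ p) := by
  have hκ := isProbWeight_gridKernel x
  have h1 : smoothing u (Function.update x j a') - smoothing u x =
      pexp (gridKernel x) (fun w => score (x j) a' (w j) *
        (u w - u (Function.update w j (x j)))) := by
    rw [smoothing_update_sub]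
    simp only [mul_sub, pexp_sub]
    rw [pexp_mul_of_update hκ j (score (x j) a') (fun w => u (Function.update w j (x j)))]
    · have : ∑ a, gridKernel x j a * score (x j) a' a = 0 := sum_geomKernel_mul_score _ _
      rw [this, zero_mul, sub_zero]
    · intro w a
      rw [Function.update_idem]
  rw [h1, ← pexp_const_mul]
  refine (abs_pexp_rpow_le hκ hp _).trans (pexp_mono hκ fun w => ?_)
  rw [← Real.mul_rpow (by norm_num) (abs_nonneg _), abs_mul]
  refine Real.rpow_le_rpow (by positivity) ?_ (by linarith)
  exact mul_le_mul_of_nonneg_right (abs_score_le ha' _) (abs_nonneg _)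

lemma pathDist_upNbr (a : Fin m) : pathDist a (upNbr a) ≤ 1 := by
  have := a.2
  simp only [pathDist, upNbr]; omega

lemma pathDist_downNbr (a : Fin m) : pathDist a (downNbr a) ≤ 1 := by
  simp only [pathDist, downNbr]; omega

lemma sum_sqGrad_smoothing_rpow_le {p : ℝ} (hp : 2 ≤ p) (u : (Fin n → Fin m) → ℝ)
    (x : Fin n → Fin m) :
    (∑ j, sqGrad upNbr downNbr (smoothing u) j x) ^ (p / 2) ≤
      18 ^ (p / 2) * pexp (gridKernel x) (fun w => |u w - u x| ^ p) := by
  have hκ := isProbWeight_gridKernel x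
  have h1 : ∑ j, sqGrad upNbr downNbr (smoothing u) j x ≤
      18 * pexp (gridKernel x) (fun w => (u w - u x) ^ 2) := by
    have h1 := sum_sq_smoothing_le u x upNbr pathDist_upNbr
    have h2 := sum_sq_smoothing_le u x downNbr pathDist_downNbr
    simp only [sqGrad, sum_add_distrib]
    linarith
  have h0 : 0 ≤ pexp (gridKernel x) (fun w => (u w - u x) ^ 2) :=
    pexp_nonneg hκ fun w => sq_nonneg _
  refine (Real.rpow_le_rpow (sum_nonneg fun j _ => sqGrad_nonneg _ _ _ _ _) h1
    (by linarith)).trans ?_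
  rw [Real.mul_rpow (by norm_num) h0]
  refine mul_le_mul_of_nonneg_left ?_ (by positivity)
  refine (pexp_rpow_le hκ (by linarith : 1 ≤ p / 2) fun w => sq_nonneg _).trans
    (le_of_eq ?_)
  congr 1
  funext w
  rw [← sq_abs, ← Real.rpow_natCast, ← Real.rpow_mul (abs_nonneg _)]
  congr 1
  push_cast
  ring

lemma sq_add_sq_rpow_le {p A B T : ℝ} (hp : 0 ≤ p) (hA : 0 ≤ A) (hB : 0 ≤ B) (h1 : A ^ p ≤ T)
    (h2 : B ^ p ≤ T) : (A ^ 2 + B ^ 2) ^ (p / 2) ≤ 2 ^ (p / 2) * T := by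
  have h3 : A ^ 2 + B ^ 2 ≤ 2 * max A B ^ 2 := by
    have ha : A ^ 2 ≤ max A B ^ 2 := pow_le_pow_left₀ hA (le_max_left _ _) 2
    have hb : B ^ 2 ≤ max A B ^ 2 := pow_le_pow_left₀ hB (le_max_right _ _) 2
    linarith
  have hM : 0 ≤ max A B := hA.trans (le_max_left _ _)
  have h4 : max A B ^ p ≤ T := by
    rcases le_total A B with h | h
    · rw [max_eq_right h]; exact h2
    · rw [max_eq_left h]; exact h1
  refine (Real.rpow_le_rpow (by positivity) h3 (by linarith)).trans ?_
  rw [Real.mul_rpow (by norm_num) (by positivity)]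
  refine mul_le_mul_of_nonneg_left (le_trans (le_of_eq ?_) h4) (by positivity)
  rw [← Real.rpow_natCast, ← Real.rpow_mul hM]
  congr 1
  push_cast
  ring

lemma sqGrad_smoothing_rpow_le {p : ℝ} (hp : 2 ≤ p) (u : (Fin n → Fin m) → ℝ)
    (x : Fin n → Fin m) (j : Fin n) :
    sqGrad upNbr downNbr (smoothing u) j x ^ (p / 2) ≤ 2 ^ (p / 2) * (3 ^ p *
      pexp (gridKernel x) (fun w => |u w - u (Function.update w j (x j))| ^ p)) := by
  have h1 := abs_smoothing_update_rpow_le (by linarith : 1 ≤ p) u x j (pathDist_upNbr (x j))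
  have h2 := abs_smoothing_update_rpow_le (by linarith : 1 ≤ p) u x j (pathDist_downNbr (x j))
  have h3 := sq_add_sq_rpow_le (by linarith : 0 ≤ p) (abs_nonneg _) (abs_nonneg _) h1 h2
  rw [sq_abs, sq_abs] at h3
  exact h3

lemma add_add_rpow_le {p : ℝ} (hp : 0 ≤ p) {a b c : ℝ} (ha : 0 ≤ a) (hb : 0 ≤ b) (hc : 0 ≤ c) :
    (a + b + c) ^ p ≤ 3 ^ p * (a ^ p + b ^ p + c ^ p) := by
  have h1 : (a + b + c) ^ p ≤ (3 * max a (max b c)) ^ p := by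
    refine Real.rpow_le_rpow (by positivity) ?_ hp
    linarith [le_max_left a (max b c), (le_max_left b c).trans (le_max_right a (max b c)),
      (le_max_right b c).trans (le_max_right a (max b c))]
  rw [Real.mul_rpow (by norm_num) (by positivity)] at h1
  refine h1.trans (mul_le_mul_of_nonneg_left ?_ (by positivity))
  have := Real.rpow_nonneg ha p
  have := Real.rpow_nonneg hb p
  have := Real.rpow_nonneg hc p
  rcases max_choice a (max b c) with h | h <;> rw [h]
  · linarith
  · rcases max_choice b c with h | h <;> rw [h] <;> linarith

lemma wvar_resampleWeight_le (hm : 0 < m) {p : ℝ} (hp : 2 ≤ p) (χ : Fin n → Bool)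
    (y : Fin n → Fin m) (j : Fin n) (φ : Fin m → ℝ) :
    wvar (resampleWeight χ y j) (fun a => spow (p / 2) (φ a)) ≤
      (p * m) ^ 2 * ind (χ j) * ∑ a, resampleWeight χ y j a * (|φ a| ^ (p - 2) *
        ((φ (upNbr a) - φ a) ^ 2 + (φ (downNbr a) - φ a) ^ 2)) := by
  unfold resampleWeight
  rcases χ j with _ | _
  · simp [ind, wvar_single]
  · simpa [ind] using wvar_uniform_spow_le hm hp φ

/-- The differences of `u` under resampling of random coordinates, in terms of the smoothing. -/
lemma pexp_resample_pair_le (hm : 0 < m) {p : ℝ} (hp : 2 < p) (χ : Fin n → Bool)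
    (u : (Fin n → Fin m) → ℝ) :
    pexp (unifWeight n m) (fun y => pexp (resampleWeight χ y) (fun w =>
      pexp (resampleWeight χ y) (fun v => |u w - u v| ^ p))) ≤
    3 ^ p * (2 * pexp (unifWeight n m) (fun x => pexp (gridKernel x) (fun w => |u w - u x| ^ p)) +
      2 ^ p * ((p * m) ^ p * pexp (unifWeight n m) (fun x =>
        (∑ j, ind (χ j) * sqGrad upNbr downNbr (smoothing u) j x) ^ (p / 2)))) := by
  set e : (Fin n → Fin m) → ℝ := fun x => pexp (gridKernel x) (fun w => |u w - u x| ^ p) with he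
  have hU := isProbWeight_unifWeight (n := n) hm
  have hue : ∀ x, |smoothing u x - u x| ^ p ≤ e x := by
    intro x
    have hκ := isProbWeight_gridKernel x
    have := abs_pexp_rpow_le hκ (by linarith : 1 ≤ p) (fun w => u w - u x)
    rwa [pexp_sub, pexp_const hκ] at this
  rw [← pexp_unif_resample hm χ e, ← pexp_unif_resample hm χ (fun x => (∑ j, _) ^ (p / 2)),
    ← pexp_const_mul, ← pexp_const_mul, ← pexp_const_mul, ← pexp_add, ← pexp_const_mul]
  refine pexp_mono hU fun y => ?_
  have hQ := isProbWeight_resampleWeight hm χ y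
  have h1 : pexp (resampleWeight χ y) (fun w =>
      pexp (resampleWeight χ y) (fun v => |u w - u v| ^ p)) ≤
      pexp (resampleWeight χ y) (fun w => pexp (resampleWeight χ y) (fun v =>
        3 ^ p * (e w + |smoothing u w - smoothing u v| ^ p + e v))) := by
    refine pexp_mono hQ fun w => pexp_mono hQ fun v => ?_
    have h2 : |u w - u v| ≤ |smoothing u w - u w| + |smoothing u w - smoothing u v| +
        |smoothing u v - u v| := by
      have e1 : u w - u v = -(smoothing u w - u w) + (smoothing u w - smoothing u v) +
        (smoothing u v - u v) := by ring
      rw [e1]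
      refine (abs_add_le _ _).trans (add_le_add_left ((abs_add_le _ _).trans ?_) _)
      rw [abs_neg]
    refine (Real.rpow_le_rpow (abs_nonneg _) h2 (by linarith)).trans ?_
    refine (add_add_rpow_le (by linarith) (abs_nonneg _) (abs_nonneg _) (abs_nonneg _)).trans ?_
    have := hue w
    have := hue v
    gcongr
  refine h1.trans ?_
  simp only [pexp_const_mul, pexp_add, pexp_const hQ]
  refine mul_le_mul_of_nonneg_left ?_ (by positivity)
  have h3 := lp_poincare_pair hQ hp upNbr downNbr
    (B := fun j => (p * m) ^ 2 * ind (χ j)) (fun j => mul_nonneg (sq_nonneg _) (ind_nonneg _))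
    (fun j φ => wvar_resampleWeight_le hm hp.le χ y j φ) (smoothing u)
  have h4 : ∀ w, (∑ j, (p * m) ^ 2 * ind (χ j) * sqGrad upNbr downNbr (smoothing u) j w) ^ (p / 2) =
      (p * m) ^ p * (∑ j, ind (χ j) * sqGrad upNbr downNbr (smoothing u) j w) ^ (p / 2) := by
    intro w
    have hpm : 0 ≤ p * m := by positivity
    simp only [mul_assoc ((p * (m : ℝ)) ^ 2), ← mul_sum]
    rw [Real.mul_rpow (sq_nonneg _) (sum_nonneg fun j _ =>
      mul_nonneg (ind_nonneg _) (sqGrad_nonneg _ _ _ _ _)), ← Real.rpow_natCast (p * m),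
      ← Real.rpow_mul hpm]
    congr 2
    push_cast
    ring
  simp only [h4, pexp_const_mul] at h3
  linarith

lemma rosenthal_sqGrad_smoothing_le {p δ : ℝ} (hp : 2 < p) (hδ0 : 0 ≤ δ) (hδ1 : δ ≤ 1)
    (u : (Fin n → Fin m) → ℝ) (x : Fin n → Fin m) :
    pexp (bern n δ) (fun χ =>
        (∑ j, ind (χ j) * sqGrad upNbr downNbr (smoothing u) j x) ^ (p / 2)) ≤
      p / 2 * 2 ^ (p / 2 - 1) * (2 ^ (p / 2) * 3 ^ p) * (δ * ∑ j, pexp (gridKernel x)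
        (fun w => |u w - u (Function.update w j (x j))| ^ p)) +
      (2 ^ (p / 2 - 1)) ^ (p / 2) * 18 ^ (p / 2) * (δ ^ (p / 2) *
        pexp (gridKernel x) (fun w => |u w - u x| ^ p)) := by
  have hg0 : ∀ j, 0 ≤ sqGrad upNbr downNbr (smoothing u) j x := fun j => sqGrad_nonneg _ _ _ _ _
  refine (rosenthal_selectors (by linarith : 1 < p / 2) hδ0 hδ1 _ hg0).trans ?_
  refine add_le_add ?_ ?_
  · have h4 : ∑ j, sqGrad upNbr downNbr (smoothing u) j x ^ (p / 2) ≤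
        2 ^ (p / 2) * (3 ^ p * ∑ j, pexp (gridKernel x)
        (fun w => |u w - u (Function.update w j (x j))| ^ p)) := by
      rw [mul_sum, mul_sum]
      exact sum_le_sum fun j _ => sqGrad_smoothing_rpow_le hp.le u x j
    have h5 := mul_le_mul_of_nonneg_left (mul_le_mul_of_nonneg_left h4 hδ0)
      (by positivity : (0 : ℝ) ≤ p / 2 * 2 ^ (p / 2 - 1))
    refine h5.trans (le_of_eq ?_)
    ring
  · have h5 := sum_sqGrad_smoothing_rpow_le hp.le u x
    have h6 : 0 ≤ ∑ j, sqGrad upNbr downNbr (smoothing u) j x := sum_nonneg fun j _ => hg0 j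
    rw [Real.mul_rpow (by positivity) (by positivity), Real.mul_rpow hδ0 h6]
    have h7 := mul_le_mul_of_nonneg_left (mul_le_mul_of_nonneg_left h5
      (by positivity : (0 : ℝ) ≤ δ ^ (p / 2)))
      (by positivity : (0 : ℝ) ≤ (2 ^ (p / 2 - 1) : ℝ) ^ (p / 2))
    refine h7.trans (le_of_eq ?_)
    ring

lemma combine_xp_bounds {p C₁ C₂ M δ S E L Δ : ℝ} (hp : 0 < p) (hC₁ : 0 ≤ C₁) (hC₂ : 0 ≤ C₂)
    (hM : 0 ≤ M) (hδ : 0 ≤ δ) (hΔ : 0 ≤ Δ) (hS : 0 ≤ S) (hE : 0 ≤ E) (h1 : 1 ≤ M * Δ)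
    (hL : L ≤ C₁ * (δ * S) + C₂ * (Δ * E)) :
    3 ^ p * (2 * E + 2 ^ p * (p ^ p * M * L)) ≤
      3 ^ p * (2 + 2 ^ p * (p ^ p * (C₁ + C₂))) * M * (δ * S + Δ * E) := by
  have hS' : 0 ≤ δ * S := mul_nonneg hδ hS
  have hE' : 0 ≤ Δ * E := mul_nonneg hΔ hE
  have h9 : E ≤ M * (δ * S + Δ * E) := by
    have := mul_nonneg hM hS'
    nlinarith
  have h10 : L ≤ (C₁ + C₂) * (δ * S + Δ * E) := by
    nlinarith
  have h11 : p ^ p * M * L ≤ p ^ p * M * ((C₁ + C₂) * (δ * S + Δ * E)) :=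
    mul_le_mul_of_nonneg_left h10 (by positivity)
  have h12 : (2 : ℝ) ^ p * (p ^ p * M * L) ≤
      2 ^ p * (p ^ p * M * ((C₁ + C₂) * (δ * S + Δ * E))) :=
    mul_le_mul_of_nonneg_left h11 (by positivity)
  refine (mul_le_mul_of_nonneg_left (add_le_add (mul_le_mul_of_nonneg_left h9 zero_le_two) h12)
    (by positivity)).trans (le_of_eq ?_)
  ring

/-- A metric `X_p` inequality on the grid. -/
theorem exists_grid_xp_inequality {p : ℝ} (hp : 2 < p) :
    ∃ C : ℝ, 0 < C ∧ ∀ (m n : ℕ) (δ : ℝ), 0 < m → 0 < δ → δ ≤ 1 → 1 ≤ (m : ℝ) ^ 2 * δ →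
      ∀ u : (Fin n → Fin m) → ℝ,
      pexp (bern n δ) (fun χ => pexp (unifWeight n m) (fun y => pexp (resampleWeight χ y) (fun w =>
        pexp (resampleWeight χ y) (fun v => |u w - u v| ^ p)))) ≤
      C * (m : ℝ) ^ p * (δ * ∑ j, pexp (unifWeight n m) (fun x => pexp (gridKernel x)
          (fun w => |u w - u (Function.update w j (x j))| ^ p)) +
        δ ^ (p / 2) * pexp (unifWeight n m) (fun x => pexp (gridKernel x)
          (fun w => |u w - u x| ^ p))) := by
  refine ⟨3 ^ p * (2 + 2 ^ p * (p ^ p * (p / 2 * 2 ^ (p / 2 - 1) * (2 ^ (p / 2) * 3 ^ p) +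
    (2 ^ (p / 2 - 1)) ^ (p / 2) * 18 ^ (p / 2)))), by positivity, ?_⟩
  intro m n δ hm hδ0 hδ1 hmδ u
  have hp0 : 0 < p := by linarith
  have hU := isProbWeight_unifWeight (n := n) hm
  have hκ := isProbWeight_bern (n := n) hδ0.le hδ1
  refine (pexp_mono hκ fun χ => pexp_resample_pair_le hm hp χ u).trans ?_
  rw [pexp_const_mul, pexp_add, pexp_const hκ, pexp_const_mul, pexp_const_mul, pexp_comm,
    Real.mul_rpow hp0.le (by positivity)]
  refine combine_xp_bounds hp0 (by positivity) (by positivity) (by positivity) hδ0.le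
    (by positivity) (sum_nonneg fun j _ => pexp_nonneg hU fun x =>
      pexp_nonneg (isProbWeight_gridKernel x) fun w => Real.rpow_nonneg (abs_nonneg _) _)
    (pexp_nonneg hU fun x => pexp_nonneg (isProbWeight_gridKernel x) fun w =>
      Real.rpow_nonneg (abs_nonneg _) _) ?_ ?_
  · have h8 : (m : ℝ) ^ p = ((m : ℝ) ^ 2) ^ (p / 2) := by
      rw [← Real.rpow_natCast, ← Real.rpow_mul (by positivity)]
      congr 1
      push_cast
      ring
    rw [h8, ← Real.mul_rpow (by positivity) hδ0.le]
    exact Real.one_le_rpow hmδ (by positivity)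
  · refine (pexp_mono hU fun x => rosenthal_sqGrad_smoothing_le hp hδ0.le hδ1 u x).trans
      (le_of_eq ?_)
    rw [pexp_add, pexp_const_mul, pexp_const_mul, pexp_const_mul, pexp_const_mul, pexp_sum]

end GridInequality

section LpNorms

open MeasureTheory

lemma integrable_pexp {ι α : Type*} [Fintype ι] [DecidableEq ι] [Fintype α] {κ : ι → α → ℝ}
    {G : (ι → α) → ℝ → ℝ} (h : ∀ w, Integrable (G w)) :
    Integrable (fun t => pexp κ (fun w => G w t)) :=
  integrable_finsetSum _ fun w _ => (h w).const_mul _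

lemma integral_pexp {ι α : Type*} [Fintype ι] [DecidableEq ι] [Fintype α] {κ : ι → α → ℝ}
    {G : (ι → α) → ℝ → ℝ} (h : ∀ w, Integrable (G w)) :
    ∫ t, pexp κ (fun w => G w t) = pexp κ (fun w => ∫ t, G w t) := by
  unfold pexp
  rw [integral_finsetSum _ fun w _ => (h w).const_mul _]
  simp only [integral_const_mul]

lemma norm_rpow_eq_integral {p : ℝ} (hp : 0 < p) (f : LpSpace p) :
    ‖f‖ ^ p = ∫ t, |f t| ^ p := by
  have h0 : ENNReal.ofReal p ≠ 0 := by simpa using hp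
  rw [Lp.norm_def, MemLp.eLpNorm_eq_integral_rpow_norm h0 ENNReal.ofReal_ne_top (Lp.memLp f),
    ENNReal.toReal_ofReal (by positivity), ENNReal.toReal_ofReal hp.le,
    ← Real.rpow_mul (by positivity), inv_mul_cancel₀ hp.ne', Real.rpow_one]
  rfl

lemma ae_sub_rpow {p : ℝ} (f g : LpSpace p) :
    (fun t => |(f - g : LpSpace p) t| ^ p) =ᵐ[volume] fun t => |f t - g t| ^ p := by
  filter_upwards [Lp.coeFn_sub f g] with t ht
  rw [ht, Pi.sub_apply]

lemma norm_sub_rpow_eq_integral {p : ℝ} (hp : 0 < p) (f g : LpSpace p) :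
    ‖f - g‖ ^ p = ∫ t, |f t - g t| ^ p :=
  (norm_rpow_eq_integral hp _).trans (integral_congr_ae (ae_sub_rpow f g))

lemma integrable_abs_sub_rpow {p : ℝ} (hp : 0 < p) (f g : LpSpace p) :
    Integrable (fun t => |f t - g t| ^ p) := by
  have h0 : ENNReal.ofReal p ≠ 0 := by simpa using hp
  have h := (Lp.memLp (f - g : LpSpace p)).integrable_norm_rpow h0 ENNReal.ofReal_ne_top
  rw [ENNReal.toReal_ofReal hp.le] at h
  exact h.congr (ae_sub_rpow f g)

/-- The metric `X_p` inequality for functions on the grid with values in `L_p`. -/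
theorem exists_grid_xp_inequality_norm {p : ℝ} (hp : 2 < p) :
    ∃ C : ℝ, 0 < C ∧ ∀ (m n : ℕ) (δ : ℝ), 0 < m → 0 < δ → δ ≤ 1 → 1 ≤ (m : ℝ) ^ 2 * δ →
      ∀ f : (Fin n → Fin m) → LpSpace p,
      pexp (bern n δ) (fun χ => pexp (unifWeight n m) (fun y => pexp (resampleWeight χ y) (fun w =>
        pexp (resampleWeight χ y) (fun v => ‖f w - f v‖ ^ p)))) ≤
      C * (m : ℝ) ^ p * (δ * ∑ j, pexp (unifWeight n m) (fun x => pexp (gridKernel x)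
          (fun w => ‖f w - f (Function.update w j (x j))‖ ^ p)) +
        δ ^ (p / 2) * pexp (unifWeight n m) (fun x => pexp (gridKernel x)
          (fun w => ‖f w - f x‖ ^ p))) := by
  obtain ⟨C, hC, h⟩ := exists_grid_xp_inequality hp
  refine ⟨C, hC, fun m n δ hm hδ0 hδ1 hmδ f => ?_⟩
  have hp0 : 0 < p := by linarith
  have hi : ∀ a b, Integrable (fun t => |f a t - f b t| ^ p) := fun a b =>
    integrable_abs_sub_rpow hp0 _ _
  have hi1 : ∀ (χ : Fin n → Bool) y w, Integrable (fun t => pexp (resampleWeight χ y)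
    (fun v => |f w t - f v t| ^ p)) := fun χ y w => integrable_pexp fun v => hi w v
  have hi2 : ∀ (χ : Fin n → Bool) y, Integrable (fun t => pexp (resampleWeight χ y) (fun w =>
    pexp (resampleWeight χ y) (fun v => |f w t - f v t| ^ p))) := fun χ y =>
    integrable_pexp fun w => hi1 χ y w
  have hi3 : ∀ (χ : Fin n → Bool), Integrable (fun t => pexp (unifWeight n m) (fun y =>
    pexp (resampleWeight χ y) (fun w => pexp (resampleWeight χ y)
      (fun v => |f w t - f v t| ^ p)))) := fun χ => integrable_pexp fun y => hi2 χ y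
  have hi4 : Integrable (fun t => pexp (bern n δ) (fun χ => pexp (unifWeight n m) (fun y =>
    pexp (resampleWeight χ y) (fun w => pexp (resampleWeight χ y)
      (fun v => |f w t - f v t| ^ p))))) := integrable_pexp fun χ => hi3 χ
  have hj1 : ∀ j (x : Fin n → Fin m), Integrable (fun t => pexp (gridKernel x)
    (fun w => |f w t - f (Function.update w j (x j)) t| ^ p)) := fun j x =>
    integrable_pexp fun w => hi _ _
  have hj2 : ∀ j, Integrable (fun t => pexp (unifWeight n m) (fun x => pexp (gridKernel x)
    (fun w => |f w t - f (Function.update w j (x j)) t| ^ p))) := fun j =>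
    integrable_pexp fun x => hj1 j x
  have hk1 : ∀ (x : Fin n → Fin m), Integrable (fun t => pexp (gridKernel x)
    (fun w => |f w t - f x t| ^ p)) := fun x => integrable_pexp fun w => hi _ _
  have hk2 : Integrable (fun t => pexp (unifWeight n m) (fun x => pexp (gridKernel x)
    (fun w => |f w t - f x t| ^ p))) := integrable_pexp fun x => hk1 x
  have hj3 : Integrable (fun t => δ * ∑ j, pexp (unifWeight n m) (fun x => pexp (gridKernel x)
    (fun w => |f w t - f (Function.update w j (x j)) t| ^ p))) :=
    (integrable_finsetSum _ fun j _ => hj2 j).const_mul _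
  have key := integral_mono hi4 ((hj3.add (hk2.const_mul (δ ^ (p / 2)))).const_mul
    (C * (m : ℝ) ^ p)) fun t => h m n δ hm hδ0 hδ1 hmδ (fun x => f x t)
  rw [integral_const_mul] at key
  simp only [Pi.add_apply] at key
  rw [integral_add hj3 (hk2.const_mul _), integral_const_mul, integral_const_mul,
    integral_finsetSum _ fun j _ => hj2 j, integral_pexp hi3, integral_pexp hk1] at key
  simp only [integral_pexp (hj1 _), integral_pexp (hi2 _), integral_pexp (hi1 _ _),
    integral_pexp fun w => hi w _] at key
  simp only [integral_pexp (fun v => hi _ v), ← norm_sub_rpow_eq_integral hp0] at key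
  exact key

end LpNorms

section LowerBound

variable {n m : ℕ}

lemma gridDist_nonneg (q : ℝ) (x y : Fin n → Fin m) : 0 ≤ gridDist q x y := by
  unfold gridDist lqDist; positivity

lemma gridDist_rpow {q : ℝ} (p : ℝ) (x y : Fin n → Fin m) :
    gridDist q x y ^ p = (∑ j, (pathDist (y j) (x j) : ℝ) ^ q) ^ (p / q) := by
  unfold gridDist lqDist
  rw [← Real.rpow_mul (by positivity), one_div_mul_eq_div]
  simp only [cast_pathDist, abs_sub_comm]

lemma gridDist_update_rpow {q : ℝ} (hq : 0 < q) (p : ℝ) (w : Fin n → Fin m) (j : Fin n)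
    (a : Fin m) :
    gridDist q w (Function.update w j a) ^ p = (pathDist a (w j) : ℝ) ^ p := by
  rw [gridDist_rpow, sum_eq_single j]
  · rw [Function.update_self, ← Real.rpow_mul (by positivity), mul_div_cancel₀ _ hq.ne']
  · intro i _ hi
    rw [Function.update_of_ne hi]
    simp [pathDist, hq.ne']
  · simp

lemma pexp_gridDist_rpow_le {p q M : ℝ} (hq : 0 < q) (hqp : q ≤ p)
    (hM : ∀ a : Fin m, ∑ b, geomKernel a b * (pathDist a b : ℝ) ^ p ≤ M)
    (x : Fin n → Fin m) (hn : 0 < n) :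
    pexp (gridKernel x) (fun w => gridDist q w x ^ p) ≤ M * (n : ℝ) ^ (p / q) := by
  have hκ := isProbWeight_gridKernel x
  have hr : 1 ≤ p / q := by rwa [one_le_div hq]
  have hn' : (0 : ℝ) < n := by exact_mod_cast hn
  have h1 : ∀ w : Fin n → Fin m, gridDist q w x ^ p ≤
      (n : ℝ) ^ (p / q - 1) * ∑ j, (pathDist (x j) (w j) : ℝ) ^ p := by
    intro w
    rw [gridDist_rpow]
    refine (Real.rpow_sum_le_const_mul_sum_rpow_of_nonneg univ hr
      (fun j _ => by positivity)).trans (le_of_eq ?_)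
    simp only [card_univ, Fintype.card_fin]
    congr 1
    refine sum_congr rfl fun j _ => ?_
    rw [← Real.rpow_mul (by positivity), mul_div_cancel₀ _ hq.ne']
  refine (pexp_mono hκ h1).trans ?_
  rw [pexp_const_mul, pexp_sum]
  have h2 : ∑ j, pexp (gridKernel x) (fun w => (pathDist (x j) (w j) : ℝ) ^ p) ≤ n * M := by
    refine (sum_le_card_nsmul univ _ M fun j _ => ?_).trans (by simp)
    rw [pexp_coord hκ j (fun b => (pathDist (x j) b : ℝ) ^ p)]
    exact hM (x j)
  refine (mul_le_mul_of_nonneg_left h2 (by positivity)).trans (le_of_eq ?_)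
  rw [Real.rpow_sub_one hn'.ne']
  field_simp

lemma pexp_gridDist_update_rpow_le {p q M : ℝ} (hq : 0 < q)
    (hM : ∀ a : Fin m, ∑ b, geomKernel a b * (pathDist a b : ℝ) ^ p ≤ M)
    (x : Fin n → Fin m) (j : Fin n) :
    pexp (gridKernel x) (fun w => gridDist q w (Function.update w j (x j)) ^ p) ≤ M := by
  simp only [gridDist_update_rpow hq]
  rw [pexp_coord (isProbWeight_gridKernel x) j (fun b => (pathDist (x j) b : ℝ) ^ p)]
  exact hM (x j)

lemma le_pexp_resample_gridDist_rpow {p q : ℝ} (hm : 2 ≤ m) (hq : 1 ≤ q) (hqp : q ≤ p)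
    (χ : Fin n → Bool) (y w : Fin n → Fin m) :
    ((m : ℝ) / 9) ^ p * (∑ j, ind (χ j)) ^ (p / q) ≤
      pexp (resampleWeight χ y) (fun v => gridDist q w v ^ p) := by
  have hQ := isProbWeight_resampleWeight (by omega : 0 < m) χ y
  have hr : 1 ≤ p / q := by rwa [one_le_div (by linarith)]
  have h0 : 0 ≤ ∑ j, ind (χ j) := sum_nonneg fun j _ => ind_nonneg _
  simp only [gridDist_rpow]
  refine le_trans ?_ (pexp_rpow_le hQ hr fun v => by positivity)
  have h1 : ((m : ℝ) / 9) ^ q * ∑ j, ind (χ j) ≤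
      pexp (resampleWeight χ y) (fun v => ∑ j, (pathDist (v j) (w j) : ℝ) ^ q) := by
    rw [pexp_sum, mul_sum]
    refine sum_le_sum fun j _ => ?_
    rw [pexp_coord hQ j (fun a => (pathDist a (w j) : ℝ) ^ q)]
    unfold resampleWeight
    rcases χ j with _ | _
    · simp only [ind, Bool.false_eq_true, if_false, mul_zero]
      refine sum_nonneg fun a _ => mul_nonneg ?_ (by positivity)
      rw [Pi.single_apply]
      split_ifs <;> norm_num
    · simpa [ind] using le_mean_pathDist_rpow hm hq (w j)
  have h2 := Real.rpow_le_rpow (by positivity) h1 (by linarith : 0 ≤ p / q)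
  rw [Real.mul_rpow (by positivity) h0, ← Real.rpow_mul (by positivity),
    mul_div_cancel₀ _ (by linarith : q ≠ 0)] at h2
  exact h2

lemma le_pexp_sum_ind_rpow {r δ : ℝ} (hr : 1 ≤ r) (h0 : 0 ≤ δ) (h1 : δ ≤ 1) :
    (δ * n) ^ r ≤ pexp (bern n δ) (fun χ => (∑ j, ind (χ j)) ^ r) := by
  have hκ := isProbWeight_bern (n := n) h0 h1
  refine le_trans (le_of_eq ?_) (pexp_rpow_le hκ hr fun χ => sum_nonneg fun j _ => ind_nonneg _)
  rw [pexp_sum]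
  simp only [pexp_coord hκ _ ind]
  simp [bern, ind, mul_comm]

lemma exists_distortion_inequality {p q : ℝ} (hq : 2 ≤ q) (hqp : q < p) :
    ∃ C : ℝ, 0 < C ∧ ∀ (m n : ℕ) (δ D : ℝ), 2 ≤ m → 0 < n → 0 < δ → δ ≤ 1 →
      1 ≤ (m : ℝ) ^ 2 * δ → 0 ≤ D → ∀ f : (Fin n → Fin m) → LpSpace p,
      (∀ x y, gridDist q x y ≤ ‖f x - f y‖ ∧ ‖f x - f y‖ ≤ D * gridDist q x y) →
      (δ * n) ^ (p / q) ≤ C * D ^ p * (δ * n + δ ^ (p / 2) * (n : ℝ) ^ (p / q)) := by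
  have hp : 2 < p := by linarith
  have hp0 : 0 < p := by linarith
  have hq0 : 0 < q := by linarith
  have hr : 1 ≤ p / q := by rw [one_le_div hq0]; exact hqp.le
  obtain ⟨C, hC, h⟩ := exists_grid_xp_inequality_norm hp
  obtain ⟨M, hM0, hM⟩ := exists_geomKernel_moment hp0
  refine ⟨9 ^ p * C * M, by positivity, ?_⟩
  intro m n δ D hm hn hδ0 hδ1 hmδ hD f hf
  have hm0 : 0 < m := by omega
  have hmp : (0 : ℝ) < (m : ℝ) ^ p := by positivity
  have hU := isProbWeight_unifWeight (n := n) hm0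
  have hκ := isProbWeight_bern (n := n) hδ0.le hδ1
  have hup : ∀ x y, ‖f x - f y‖ ^ p ≤ D ^ p * gridDist q x y ^ p := fun x y => by
    rw [← Real.mul_rpow hD (gridDist_nonneg _ _ _)]
    exact Real.rpow_le_rpow ((gridDist_nonneg _ _ _).trans (hf x y).1) (hf x y).2 hp0.le
  have hlo : ∀ x y, gridDist q x y ^ p ≤ ‖f x - f y‖ ^ p := fun x y =>
    Real.rpow_le_rpow (gridDist_nonneg _ _ _) (hf x y).1 hp0.le
  have hL : ((m : ℝ) / 9) ^ p * (δ * n) ^ (p / q) ≤ pexp (bern n δ) (fun χ =>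
      pexp (unifWeight n m) (fun y => pexp (resampleWeight χ y) (fun w =>
        pexp (resampleWeight χ y) (fun v => ‖f w - f v‖ ^ p)))) := by
    refine (mul_le_mul_of_nonneg_left (le_pexp_sum_ind_rpow hr hδ0.le hδ1)
      (by positivity)).trans ?_
    rw [← pexp_const_mul]
    refine pexp_mono hκ fun χ => ?_
    refine le_trans (le_of_eq (pexp_const hU _).symm) (pexp_mono hU fun y => ?_)
    have hQ := isProbWeight_resampleWeight hm0 χ y
    refine le_trans (le_of_eq (pexp_const hQ _).symm) (pexp_mono hQ fun w => ?_)
    exact (le_pexp_resample_gridDist_rpow hm (by linarith) hqp.le χ y w).trans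
      (pexp_mono hQ fun v => hlo w v)
  have hS : ∑ j, pexp (unifWeight n m) (fun x => pexp (gridKernel x)
      (fun w => ‖f w - f (Function.update w j (x j))‖ ^ p)) ≤ n * (D ^ p * M) := by
    refine (sum_le_card_nsmul univ _ (D ^ p * M) fun j _ => ?_).trans (by simp)
    refine le_trans (pexp_mono hU fun x => ?_) (le_of_eq (pexp_const hU _))
    refine (pexp_mono (isProbWeight_gridKernel x) fun w => hup _ _).trans ?_
    rw [pexp_const_mul]
    exact mul_le_mul_of_nonneg_left (pexp_gridDist_update_rpow_le hq0 (hM m) x j)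
      (by positivity)
  have hE : pexp (unifWeight n m) (fun x => pexp (gridKernel x)
      (fun w => ‖f w - f x‖ ^ p)) ≤ D ^ p * (M * (n : ℝ) ^ (p / q)) := by
    refine le_trans (pexp_mono hU fun x => ?_) (le_of_eq (pexp_const hU _))
    refine (pexp_mono (isProbWeight_gridKernel x) fun w => hup _ _).trans ?_
    rw [pexp_const_mul]
    exact mul_le_mul_of_nonneg_left (pexp_gridDist_rpow_le hq0 hqp.le (hM m) x hn)
      (by positivity)
  have h1 := hL.trans (h m n δ hm0 hδ0 hδ1 hmδ f)
  have h2 : ((m : ℝ) / 9) ^ p * (δ * n) ^ (p / q) ≤ C * (m : ℝ) ^ p *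
      (δ * (n * (D ^ p * M)) + δ ^ (p / 2) * (D ^ p * (M * (n : ℝ) ^ (p / q)))) :=
    h1.trans (mul_le_mul_of_nonneg_left (add_le_add (mul_le_mul_of_nonneg_left hS hδ0.le)
      (mul_le_mul_of_nonneg_left hE (by positivity))) (by positivity))
  rw [Real.div_rpow (by positivity) (by norm_num)] at h2
  have h9 : (0 : ℝ) < 9 ^ p := by positivity
  have h3 : (m : ℝ) ^ p * (δ * n) ^ (p / q) ≤ (m : ℝ) ^ p * (9 ^ p * C * M * D ^ p *
      (δ * n + δ ^ (p / 2) * (n : ℝ) ^ (p / q))) := by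
    have := mul_le_mul_of_nonneg_left h2 h9.le
    calc (m : ℝ) ^ p * (δ * n) ^ (p / q)
        = 9 ^ p * ((m : ℝ) ^ p / 9 ^ p * (δ * n) ^ (p / q)) := by field_simp
      _ ≤ _ := this
      _ = _ := by ring
  exact le_of_mul_le_mul_left h3 hmp

lemma one_div_rpow_balance {t n p q : ℝ} (ht : 0 < t) (hn : 0 < n) (hp : 2 < p)
    (htn : t ≤ n ^ (2 * (p - q) / (q * (p - 2)))) (hq : 0 < q) :
    1 / t * n ≤ (1 / t) ^ (p / 2) * n ^ (p / q) := by
  have h1 : t ^ (p / 2 - 1) ≤ n ^ (p / q - 1) := by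
    refine (Real.rpow_le_rpow ht.le htn (by linarith)).trans (le_of_eq ?_)
    rw [← Real.rpow_mul hn.le]
    congr 1
    have : p - 2 ≠ 0 := by linarith
    field_simp
  rw [Real.rpow_sub_one ht.ne', Real.rpow_sub_one hn.ne', div_le_div_iff₀ ht hn] at h1
  rw [Real.div_rpow zero_le_one ht.le, Real.one_rpow, one_div_mul_eq_div, one_div_mul_eq_div,
    div_le_div_iff₀ ht (by positivity)]
  linarith

lemma rpow_le_of_distortion_inequality {t n p q C D : ℝ} (ht : 0 < t) (hn : 0 < n) (hp : 2 < p)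
    (hq : 0 < q) (hC : 0 ≤ C) (hD : 0 ≤ D) (htn : t ≤ n ^ (2 * (p - q) / (q * (p - 2))))
    (h : (1 / t * n) ^ (p / q) ≤ C * D ^ p * (1 / t * n + (1 / t) ^ (p / 2) * n ^ (p / q))) :
    t ^ (1 / 2 - 1 / q) ≤ (2 * C) ^ (1 / p) * D := by
  have hp0 : 0 < p := by linarith
  have h1 := one_div_rpow_balance ht hn hp htn hq
  have h2 : (1 / t * n) ^ (p / q) ≤ C * D ^ p * (2 * ((1 / t) ^ (p / 2) * n ^ (p / q))) :=
    h.trans (mul_le_mul_of_nonneg_left (by linarith) (by positivity))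
  rw [Real.mul_rpow (by positivity) hn.le, one_div, Real.inv_rpow ht.le, Real.inv_rpow ht.le] at h2
  have hnr : 0 < n ^ (p / q) := by positivity
  have ht1 : 0 < t ^ (p / q) := by positivity
  have ht2 : 0 < t ^ (p / 2) := by positivity
  have h3 : t ^ (p / 2) / t ^ (p / q) ≤ 2 * C * D ^ p := by
    rw [div_le_iff₀ ht1]
    have h4 := mul_le_mul_of_nonneg_left h2
      (by positivity : 0 ≤ t ^ (p / q) * t ^ (p / 2) / n ^ (p / q))
    calc t ^ (p / 2) = t ^ (p / q) * t ^ (p / 2) / n ^ (p / q) *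
          ((t ^ (p / q))⁻¹ * n ^ (p / q)) := by field_simp
      _ ≤ _ := h4
      _ = _ := by field_simp
  rw [← Real.rpow_sub ht] at h3
  have h5 := Real.rpow_le_rpow (by positivity) h3 (by positivity : 0 ≤ 1 / p)
  rw [← Real.rpow_mul ht.le, Real.mul_rpow (by positivity) (by positivity), ← Real.rpow_mul hD,
    mul_one_div_cancel hp0.ne', Real.rpow_one] at h5
  refine le_trans (le_of_eq ?_) h5
  congr 1
  field_simp

/-- The lower bound for the distortion of a given embedding of the grid. -/
theorem exists_le_distortion {p q : ℝ} (hq : 2 ≤ q) (hqp : q < p) :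
    ∃ c : ℝ, 0 < c ∧ ∀ (m n : ℕ), 0 < m → 0 < n → ∀ D : ℝ, 1 ≤ D →
      ∀ f : (Fin n → Fin m) → LpSpace p,
      (∀ x y, gridDist q x y ≤ ‖f x - f y‖ ∧ ‖f x - f y‖ ≤ D * gridDist q x y) →
      c * min ((n : ℝ) ^ ((p - q) * (q - 2) / (q ^ 2 * (p - 2)))) ((m : ℝ) ^ (1 - 2 / q)) ≤ D := by
  have hp : 2 < p := by linarith
  have hq0 : 0 < q := by linarith
  obtain ⟨C, hC, h⟩ := exists_distortion_inequality hq hqp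
  have hC' : 0 < (2 * C) ^ (1 / p) := by positivity
  refine ⟨min 1 (1 / (2 * C) ^ (1 / p)), by positivity, ?_⟩
  intro m n hm hn D hD f hf
  have hn1 : (1 : ℝ) ≤ n := by exact_mod_cast hn
  have hm1 : (1 : ℝ) ≤ m := by exact_mod_cast hm
  rcases (by omega : m = 1 ∨ 2 ≤ m) with rfl | hm2
  · simp only [Nat.cast_one, Real.one_rpow]
    have h1 : min ((n : ℝ) ^ ((p - q) * (q - 2) / (q ^ 2 * (p - 2)))) 1 ≤ 1 := min_le_right _ _
    have h2 : min 1 (1 / (2 * C) ^ (1 / p)) ≤ 1 := min_le_left _ _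
    exact (mul_le_one₀ h2 (by positivity) h1).trans hD
  · have hK1 : 1 ≤ (n : ℝ) ^ (2 * (p - q) / (q * (p - 2))) :=
      Real.one_le_rpow hn1 (div_nonneg (by linarith) (mul_nonneg hq0.le (by linarith)))
    have hm21 : 1 ≤ (m : ℝ) ^ 2 := one_le_pow₀ hm1
    obtain ⟨t, ht⟩ : ∃ t, t = min ((n : ℝ) ^ (2 * (p - q) / (q * (p - 2)))) ((m : ℝ) ^ 2) :=
      ⟨_, rfl⟩
    have ht1 : 1 ≤ t := ht ▸ le_min hK1 hm21
    have htn : t ≤ (n : ℝ) ^ (2 * (p - q) / (q * (p - 2))) := ht ▸ min_le_left _ _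
    have htm : t ≤ (m : ℝ) ^ 2 := ht ▸ min_le_right _ _
    have ht0 : 0 < t := by linarith
    have h1 := h m n (1 / t) D hm2 hn (by positivity) (by rwa [div_le_one ht0])
      (by rwa [mul_one_div, one_le_div ht0]) (by linarith) f hf
    have h2 := rpow_le_of_distortion_inequality ht0 (by linarith) hp hq0 hC.le (by linarith) htn h1
    have h3 : min ((n : ℝ) ^ ((p - q) * (q - 2) / (q ^ 2 * (p - 2)))) ((m : ℝ) ^ (1 - 2 / q)) ≤
        t ^ (1 / 2 - 1 / q) := by
      have e1 : (n : ℝ) ^ ((p - q) * (q - 2) / (q ^ 2 * (p - 2))) =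
          ((n : ℝ) ^ (2 * (p - q) / (q * (p - 2)))) ^ (1 / 2 - 1 / q) := by
        rw [← Real.rpow_mul (by positivity)]
        congr 1
        have : p - 2 ≠ 0 := by linarith
        field_simp
      have e2 : (m : ℝ) ^ (1 - 2 / q) = ((m : ℝ) ^ 2) ^ (1 / 2 - 1 / q) := by
        rw [← Real.rpow_natCast, ← Real.rpow_mul (by positivity)]
        congr 1
        push_cast
        field_simp
      rw [e1, e2, ht]
      rcases min_choice ((n : ℝ) ^ (2 * (p - q) / (q * (p - 2)))) ((m : ℝ) ^ 2) with h | h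
      · rw [h]; exact min_le_left _ _
      · rw [h]; exact min_le_right _ _
    have hmin0 : 0 ≤ min ((n : ℝ) ^ ((p - q) * (q - 2) / (q ^ 2 * (p - 2))))
        ((m : ℝ) ^ (1 - 2 / q)) := le_min (by positivity) (by positivity)
    calc _ ≤ 1 / (2 * C) ^ (1 / p) * min ((n : ℝ) ^ ((p - q) * (q - 2) / (q ^ 2 * (p - 2))))
          ((m : ℝ) ^ (1 - 2 / q)) := mul_le_mul_of_nonneg_right (min_le_right _ _) hmin0
      _ ≤ 1 / (2 * C) ^ (1 / p) * ((2 * C) ^ (1 / p) * D) :=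
          mul_le_mul_of_nonneg_left (h3.trans h2) (by positivity)
      _ = D := by field_simp

end LowerBound

section Realization

open MeasureTheory

variable {I : Type*} [Fintype I]

/-- A unit interval for each index. -/
noncomputable def unitCell (i : I) : Set ℝ :=
  Set.Ico ((Fintype.equivFin I i : ℕ) : ℝ) ((Fintype.equivFin I i : ℕ) + 1)

lemma measurableSet_unitCell (i : I) : MeasurableSet (unitCell i) := measurableSet_Ico

lemma volume_unitCell (i : I) : volume (unitCell i) = 1 := by simp [unitCell]

lemma unitCell_unique {i j : I} {t : ℝ} (hi : t ∈ unitCell i) (hj : t ∈ unitCell j) : i = j := by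
  simp only [unitCell, Set.mem_Ico] at hi hj
  have h1 : ((Fintype.equivFin I i : ℕ) : ℝ) < (Fintype.equivFin I j : ℕ) + 1 := by linarith
  have h2 : ((Fintype.equivFin I j : ℕ) : ℝ) < (Fintype.equivFin I i : ℕ) + 1 := by linarith
  have h3 : (Fintype.equivFin I i : ℕ) < (Fintype.equivFin I j : ℕ) + 1 := by exact_mod_cast h1
  have h4 : (Fintype.equivFin I j : ℕ) < (Fintype.equivFin I i : ℕ) + 1 := by exact_mod_cast h2
  exact (Fintype.equivFin I).injective (Fin.ext (by omega))

/-- The step function with prescribed values on the unit cells. -/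
noncomputable def stepFun (F : I → ℝ) (t : ℝ) : ℝ :=
  ∑ i, (unitCell i).indicator (fun _ => F i) t

lemma stepFun_of_mem (F : I → ℝ) {i : I} {t : ℝ} (h : t ∈ unitCell i) : stepFun F t = F i := by
  unfold stepFun
  rw [sum_eq_single i, Set.indicator_of_mem h]
  · intro j _ hj
    exact Set.indicator_of_notMem (fun h' => hj (unitCell_unique h' h)) _
  · simp

lemma stepFun_of_notMem (F : I → ℝ) {t : ℝ} (h : ∀ i : I, t ∉ unitCell i) : stepFun F t = 0 :=
  sum_eq_zero fun i _ => Set.indicator_of_notMem (h i) _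

lemma integral_stepFun (F : I → ℝ) : ∫ t, stepFun F t = ∑ i, F i := by
  unfold stepFun
  rw [integral_finsetSum]
  · refine sum_congr rfl fun i _ => ?_
    rw [integral_indicator (measurableSet_unitCell i), setIntegral_const, measureReal_def,
      volume_unitCell]
    simp
  · intro i _
    exact (integrable_indicator_iff (measurableSet_unitCell i)).2
      (integrableOn_const (by simp [volume_unitCell]))

lemma memLp_stepFun (p : ENNReal) (F : I → ℝ) : MemLp (stepFun F) p volume :=
  memLp_finsetSum _ fun i _ => memLp_indicator_const p (measurableSet_unitCell i) (F i)
    (Or.inr (by simp [volume_unitCell]))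

lemma exists_LpSpace_norm_sub_rpow {p : ℝ} (hp : 0 < p) {X : Type*} (F : X → I → ℝ) :
    ∃ f : X → LpSpace p, ∀ x y, ‖f x - f y‖ ^ p = ∑ i, |F x i - F y i| ^ p := by
  refine ⟨fun x => (memLp_stepFun (ENNReal.ofReal p) (F x)).toLp _, fun x y => ?_⟩
  rw [norm_sub_rpow_eq_integral hp, ← integral_stepFun]
  refine integral_congr_ae ?_
  filter_upwards [(memLp_stepFun (ENNReal.ofReal p) (F x)).coeFn_toLp,
    (memLp_stepFun (ENNReal.ofReal p) (F y)).coeFn_toLp] with t hx hy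
  rw [hx, hy]
  by_cases h : ∃ i : I, t ∈ unitCell i
  · obtain ⟨i, hi⟩ := h
    simp only [stepFun_of_mem _ hi]
  · push Not at h
    simp [stepFun_of_notMem _ h, hp.ne']

lemma exists_embedding_of_weighted_sum {p a T : ℝ} (hp : 0 < p) (ha : 0 < a) (hT : 0 ≤ T)
    {X : Type*} {d : X → X → ℝ} (hd : ∀ x y, 0 ≤ d x y) {c : I → ℝ} (hc : ∀ i, 0 ≤ c i)
    (F : X → I → ℝ) (h1 : ∀ x y, a * d x y ^ p ≤ ∑ i, c i * |F x i - F y i| ^ p)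
    (h2 : ∀ x y, ∑ i, c i * |F x i - F y i| ^ p ≤ a * T ^ p * d x y ^ p) :
    ∃ f : X → LpSpace p, ∀ x y, d x y ≤ ‖f x - f y‖ ∧ ‖f x - f y‖ ≤ T * d x y := by
  obtain ⟨f, hf⟩ := exists_LpSpace_norm_sub_rpow hp (fun x i => (c i / a) ^ (1 / p) * F x i)
  have hf' : ∀ x y, ‖f x - f y‖ ^ p = (∑ i, c i * |F x i - F y i| ^ p) / a := by
    intro x y
    rw [hf, sum_div]
    refine sum_congr rfl fun i _ => ?_
    have h0 : 0 ≤ c i / a := div_nonneg (hc i) ha.le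
    rw [← mul_sub, abs_mul, Real.mul_rpow (abs_nonneg _) (abs_nonneg _),
      abs_of_nonneg (Real.rpow_nonneg h0 _), ← Real.rpow_mul h0, one_div_mul_cancel hp.ne',
      Real.rpow_one]
    ring
  have hn : ∀ x y, 0 ≤ ‖f x - f y‖ := fun x y => by
    rw [Lp.norm_def]
    exact ENNReal.toReal_nonneg
  refine ⟨f, fun x y => ⟨?_, ?_⟩⟩
  · refine (Real.rpow_le_rpow_iff (hd x y) (hn x y) hp).1 ?_
    rw [hf', le_div_iff₀ ha, mul_comm]
    exact h1 x y
  · refine (Real.rpow_le_rpow_iff (hn x y) (mul_nonneg hT (hd x y)) hp).1 ?_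
    rw [hf', div_le_iff₀ ha, Real.mul_rpow hT (hd x y)]
    refine (h2 x y).trans (le_of_eq ?_)
    ring

end Realization

section Khinchine

variable {n : ℕ}

/-- The fair weights on `Bool`. -/
noncomputable def fairWeight (n : ℕ) : Fin n → Bool → ℝ := fun _ _ => 1 / 2

/-- The sign attached to a Boolean. -/
def boolSign (b : Bool) : ℝ := if b then 1 else -1

lemma isProbWeight_fairWeight : IsProbWeight (fairWeight n) :=
  ⟨fun _ _ => by unfold fairWeight; norm_num, fun _ => by simp [fairWeight]⟩

lemma abs_boolSign (b : Bool) : |boolSign b| = 1 := by cases b <;> simp [boolSign]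

lemma le_pexp_fair_rpow {α : ℝ} (hα : 2 ≤ α) (d : Fin n → ℝ) :
    (∑ j, d j ^ 2) ^ (α / 2) ≤ pexp (fairWeight n) (fun ε => |∑ j, d j * boolSign (ε j)| ^ α) := by
  have h1 := pexp_sq_sum (isProbWeight_fairWeight (n := n)) (fun _ => boolSign)
    (fun j => by simp [fairWeight, boolSign]) d
  have h2 : ∀ j : Fin n, ∑ a, fairWeight n j a * boolSign a ^ 2 = 1 := fun j => by
    simp [fairWeight, boolSign]
  simp only [h2, mul_one] at h1
  rw [← h1]
  refine (pexp_rpow_le isProbWeight_fairWeight (by linarith : 1 ≤ α / 2)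
    fun ε => sq_nonneg _).trans (le_of_eq ?_)
  congr 1
  funext ε
  rw [← sq_abs, ← Real.rpow_natCast, ← Real.rpow_mul (abs_nonneg _)]
  congr 1
  push_cast
  ring

lemma exists_abs_rpow_le_cosh {α : ℝ} (hα : 0 ≤ α) :
    ∃ C : ℝ, 0 < C ∧ ∀ x : ℝ, |x| ^ α ≤ C * Real.cosh x := by
  refine ⟨2 * (1 + (⌈α⌉₊.factorial : ℝ)), by positivity, fun x => ?_⟩
  have h1 : |x| ^ α ≤ 1 + |x| ^ ⌈α⌉₊ := by
    rcases le_total |x| 1 with h | h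
    · have := Real.rpow_le_one (abs_nonneg x) h hα
      have : 0 ≤ |x| ^ ⌈α⌉₊ := by positivity
      linarith
    · have := Real.rpow_le_rpow_of_exponent_le h (Nat.le_ceil α)
      rw [Real.rpow_natCast] at this
      linarith
  have h2 := Real.pow_div_factorial_le_exp |x| (abs_nonneg x) ⌈α⌉₊
  rw [div_le_iff₀ (by positivity)] at h2
  have h3 : 1 ≤ Real.exp |x| := Real.one_le_exp (abs_nonneg x)
  have h4 : Real.exp |x| ≤ 2 * Real.cosh x := by
    rw [← Real.cosh_abs, Real.cosh_eq]
    have := Real.exp_pos (-|x|)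
    linarith
  have h5 : (0 : ℝ) < ⌈α⌉₊.factorial := by positivity
  calc |x| ^ α ≤ (1 + (⌈α⌉₊.factorial : ℝ)) * Real.exp |x| := by linarith
    _ ≤ (1 + (⌈α⌉₊.factorial : ℝ)) * (2 * Real.cosh x) := by gcongr
    _ = _ := by ring

lemma pexp_fair_exp (d : Fin n → ℝ) :
    pexp (fairWeight n) (fun ε => Real.exp (∑ j, d j * boolSign (ε j))) = ∏ j, Real.cosh (d j) := by
  simp only [Real.exp_sum]
  rw [pexp_prod (fairWeight n) (fun j b => Real.exp (d j * boolSign b))]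
  refine prod_congr rfl fun j _ => ?_
  rw [Real.cosh_eq]
  simp [fairWeight, boolSign]
  ring

lemma pexp_fair_cosh (d : Fin n → ℝ) :
    pexp (fairWeight n) (fun ε => Real.cosh (∑ j, d j * boolSign (ε j))) =
      ∏ j, Real.cosh (d j) := by
  have h1 := pexp_fair_exp d
  have h2 := pexp_fair_exp (fun j => - d j)
  simp only [Real.cosh_neg, neg_mul, sum_neg_distrib] at h2
  have h3 : ∀ x : ℝ, Real.cosh x = 1 / 2 * (Real.exp x + Real.exp (-x)) := fun x => by
    rw [Real.cosh_eq]; ring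
  rw [funext fun ε : Fin n → Bool => h3 (∑ j, d j * boolSign (ε j)), pexp_const_mul, pexp_add,
    h1, h2]
  ring

lemma exists_pexp_fair_rpow_le {α : ℝ} (hα : 2 ≤ α) :
    ∃ C : ℝ, 0 < C ∧ ∀ (n : ℕ) (d : Fin n → ℝ),
      pexp (fairWeight n) (fun ε => |∑ j, d j * boolSign (ε j)| ^ α) ≤
        C * (∑ j, d j ^ 2) ^ (α / 2) := by
  obtain ⟨C, hC, h⟩ := exists_abs_rpow_le_cosh (by linarith : 0 ≤ α)
  refine ⟨C * Real.exp (1 / 2), by positivity, fun n d => ?_⟩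
  have hκ := isProbWeight_fairWeight (n := n)
  have hS0 : 0 ≤ ∑ j, d j ^ 2 := sum_nonneg fun j _ => sq_nonneg _
  rcases hS0.eq_or_lt with hS | hS
  · have hd : ∀ j, d j = 0 := fun j => by
      have := (sum_eq_zero_iff_of_nonneg fun j _ => sq_nonneg (d j)).1 hS.symm j (mem_univ j)
      simpa using this
    simp [hd, (by linarith : α ≠ 0), (by linarith : α / 2 ≠ 0), pexp]
  · obtain ⟨s, hs⟩ : ∃ s, s = Real.sqrt (∑ j, d j ^ 2) := ⟨_, rfl⟩
    have hs0 : 0 < s := hs ▸ Real.sqrt_pos.2 hS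
    have hs2 : s ^ 2 = ∑ j, d j ^ 2 := hs ▸ Real.sq_sqrt hS.le
    have h1 : ∀ ε : Fin n → Bool, |∑ j, d j * boolSign (ε j)| ^ α ≤
        s ^ α * (C * Real.cosh (∑ j, d j / s * boolSign (ε j))) := by
      intro ε
      have e1 : ∑ j, d j * boolSign (ε j) = s * ∑ j, d j / s * boolSign (ε j) := by
        rw [mul_sum]
        exact sum_congr rfl fun j _ => by field_simp
      rw [e1, abs_mul, abs_of_pos hs0, Real.mul_rpow hs0.le (abs_nonneg _)]
      exact mul_le_mul_of_nonneg_left (h _) (by positivity)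
    refine (pexp_mono hκ h1).trans ?_
    rw [pexp_const_mul, pexp_const_mul, pexp_fair_cosh]
    have h2 : ∏ j, Real.cosh (d j / s) ≤ Real.exp (1 / 2) := by
      refine (prod_le_prod (fun j _ => (Real.cosh_pos _).le)
        fun j _ => Real.cosh_le_exp_half_sq (d j / s)).trans (le_of_eq ?_)
      rw [← Real.exp_sum]
      congr 1
      simp only [div_pow]
      rw [← sum_div, ← sum_div, hs2, div_self hS.ne']
    have h3 : s ^ α = (∑ j, d j ^ 2) ^ (α / 2) := by
      rw [← hs2, ← Real.rpow_natCast, ← Real.rpow_mul hs0.le]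
      congr 1
      push_cast
      ring
    rw [← h3]
    calc s ^ α * (C * ∏ j, Real.cosh (d j / s)) ≤ s ^ α * (C * Real.exp (1 / 2)) := by gcongr
      _ = _ := by ring

end Khinchine

section RandomSumEmbedding

variable {n m : ℕ}

/-- The coordinate difference of two grid points. -/
def gridSub (x y : Fin n → Fin m) (j : Fin n) : ℝ := ((x j : ℕ) : ℝ) - ((y j : ℕ) : ℝ)

lemma gridDist_rpow_eq {q : ℝ} (p : ℝ) (x y : Fin n → Fin m) :
    gridDist q x y ^ p = (∑ j, |gridSub x y j| ^ q) ^ (p / q) := by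
  unfold gridDist lqDist gridSub
  rw [← Real.rpow_mul (by positivity), one_div_mul_eq_div]

lemma sum_rpow_le_rpow_sum {r : ℝ} (hr : 1 ≤ r) (a : Fin n → ℝ) (ha : ∀ j, 0 ≤ a j) :
    ∑ j, a j ^ r ≤ (∑ j, a j) ^ r := by
  have hS : 0 ≤ ∑ j, a j := sum_nonneg fun j _ => ha j
  have h1 : ∀ t : ℝ, 0 ≤ t → t ^ r = t * t ^ (r - 1) := fun t ht => by
    rw [← Real.rpow_one_add' ht (by linarith)]
    congr 1
    ring
  rw [h1 _ hS, sum_mul]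
  refine sum_le_sum fun j _ => ?_
  rw [h1 _ (ha j)]
  exact mul_le_mul_of_nonneg_left (Real.rpow_le_rpow (ha j)
    (single_le_sum (fun i _ => ha i) (mem_univ j)) (by linarith)) (ha j)

lemma sum_sq_rpow_le {p q : ℝ} (hp : 0 ≤ p) (hq : 2 ≤ q) (d : Fin n → ℝ) :
    (∑ j, d j ^ 2) ^ (p / 2) ≤ (n : ℝ) ^ (p * (1 / 2 - 1 / q)) * (∑ j, |d j| ^ q) ^ (p / q) := by
  have hq0 : 0 < q := by linarith
  have h1 := Real.rpow_sum_le_const_mul_sum_rpow_of_nonneg (univ : Finset (Fin n))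
    (f := fun j => d j ^ 2) (by linarith : 1 ≤ q / 2) (fun j _ => sq_nonneg _)
  have h2 : ∀ j, (d j ^ 2) ^ (q / 2) = |d j| ^ q := fun j => by
    rw [← sq_abs, ← Real.rpow_natCast, ← Real.rpow_mul (abs_nonneg _)]
    congr 1
    push_cast
    ring
  simp only [h2, card_univ, Fintype.card_fin] at h1
  have hS : 0 ≤ ∑ j, d j ^ 2 := sum_nonneg fun j _ => sq_nonneg _
  have h3 := Real.rpow_le_rpow (by positivity) h1 (by positivity : 0 ≤ p / q)
  rw [← Real.rpow_mul hS, Real.mul_rpow (by positivity) (by positivity),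
    ← Real.rpow_mul (by positivity)] at h3
  refine (le_of_eq ?_).trans (h3.trans (le_of_eq ?_))
  · congr 1
    field_simp
  · congr 2
    field_simp

lemma sum_abs_rpow_le_interpolate {p q : ℝ} (hq : 2 ≤ q) (hqp : q < p) (d : Fin n → ℝ) :
    ∑ j, |d j| ^ q ≤ (∑ j, d j ^ 2) ^ ((p - q) / (p - 2)) *
      (∑ j, |d j| ^ p) ^ ((q - 2) / (p - 2)) := by
  have hp2 : 0 < p - 2 := by linarith
  rcases hq.eq_or_lt with rfl | hq2
  · simp [hp2.ne']
  · have hpq : 0 < p - q := by linarith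
    have hq2' : 0 < q - 2 := by linarith
    have hc : ((p - 2) / (p - q)).HolderConjugate ((p - 2) / (q - 2)) := by
      rw [Real.holderConjugate_iff]
      refine ⟨by rw [one_lt_div hpq]; linarith, ?_⟩
      rw [inv_div, inv_div, ← add_div, div_eq_one_iff_eq hp2.ne']
      ring
    have h1 := Real.inner_le_Lp_mul_Lq_of_nonneg (univ : Finset (Fin n)) hc
      (f := fun j => |d j| ^ (2 * ((p - q) / (p - 2))))
      (g := fun j => |d j| ^ (p * ((q - 2) / (p - 2)))) (fun j _ => by positivity)
      (fun j _ => by positivity)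
    refine (le_of_eq ?_).trans (h1.trans (le_of_eq ?_))
    · refine sum_congr rfl fun j _ => ?_
      have e : 2 * ((p - q) / (p - 2)) + p * ((q - 2) / (p - 2)) = q := by
        field_simp
        ring
      rw [← Real.rpow_add' (abs_nonneg _) (by rw [e]; linarith), e]
    · rw [one_div_div, one_div_div]
      congr 2
      · refine sum_congr rfl fun j _ => ?_
        rw [← Real.rpow_mul (abs_nonneg _), ← sq_abs, ← Real.rpow_natCast]
        congr 1
        push_cast
        field_simp
      · refine sum_congr rfl fun j _ => ?_
        rw [← Real.rpow_mul (abs_nonneg _)]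
        congr 1
        field_simp

lemma rpow_le_of_interpolate {p q B S₂ Sp Sq R : ℝ} (hq : 2 ≤ q) (hqp : q < p) (hB : 0 < B)
    (hS₂ : 0 ≤ S₂) (hSp : 0 ≤ Sp) (hSq : 0 ≤ Sq)
    (h : Sq ≤ S₂ ^ ((p - q) / (p - 2)) * Sp ^ ((q - 2) / (p - 2)))
    (hR : Sp + B * S₂ ^ (p / 2) ≤ R) :
    B ^ (2 * (p - q) / (q * (p - 2))) * Sq ^ (p / q) ≤ R := by
  have hp2 : 0 < p - 2 := by linarith
  have hq0 : 0 < q := by linarith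
  have hp0 : 0 < p := by linarith
  have hpq : 0 < p - q := by linarith
  have hSpR : Sp ≤ R := by
    have : 0 ≤ B * S₂ ^ (p / 2) := by positivity
    linarith
  have hR0 : 0 ≤ R := hSp.trans hSpR
  have h2 : B * S₂ ^ (p / 2) ≤ R := by linarith
  have h3 := Real.rpow_le_rpow (by positivity) h2
    (div_nonneg (by linarith) (by positivity) : 0 ≤ 2 * (p - q) / (q * (p - 2)))
  rw [Real.mul_rpow hB.le (by positivity), ← Real.rpow_mul hS₂] at h3
  have h4 := Real.rpow_le_rpow hSp hSpR
    (div_nonneg (mul_nonneg hp0.le (by linarith)) (by positivity) :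
      0 ≤ p * (q - 2) / (q * (p - 2)))
  have h5 := Real.rpow_le_rpow hSq h (by positivity : 0 ≤ p / q)
  rw [Real.mul_rpow (by positivity) (by positivity), ← Real.rpow_mul hS₂,
    ← Real.rpow_mul hSp] at h5
  calc B ^ (2 * (p - q) / (q * (p - 2))) * Sq ^ (p / q)
      ≤ B ^ (2 * (p - q) / (q * (p - 2))) * (S₂ ^ ((p - q) / (p - 2) * (p / q)) *
        Sp ^ ((q - 2) / (p - 2) * (p / q))) := mul_le_mul_of_nonneg_left h5 (by positivity)
    _ = B ^ (2 * (p - q) / (q * (p - 2))) * S₂ ^ (p / 2 * (2 * (p - q) / (q * (p - 2)))) *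
        Sp ^ (p * (q - 2) / (q * (p - 2))) := by
        rw [mul_assoc]
        congr 3
        · field_simp
        · field_simp
    _ ≤ R ^ (2 * (p - q) / (q * (p - 2))) * R ^ (p * (q - 2) / (q * (p - 2))) :=
        mul_le_mul h3 h4 (by positivity) (by positivity)
    _ = R := by
        have e : 2 * (p - q) / (q * (p - 2)) + p * (q - 2) / (q * (p - 2)) = 1 := by
          field_simp
          ring
        rw [← Real.rpow_add' hR0 (by rw [e]; norm_num), e, Real.rpow_one]

/-- The distortion bound given by adding random sums to the coordinates. -/
theorem exists_embedding_rpow_dim {p q : ℝ} (hq : 2 ≤ q) (hqp : q < p) :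
    ∃ C : ℝ, 1 ≤ C ∧ ∀ m n : ℕ, 0 < n →
      ∃ f : (Fin n → Fin m) → LpSpace p, ∀ x y, gridDist q x y ≤ ‖f x - f y‖ ∧ ‖f x - f y‖ ≤
        C * (n : ℝ) ^ ((p - q) * (q - 2) / (q ^ 2 * (p - 2))) * gridDist q x y := by
  have hp2 : 0 < p - 2 := by linarith
  have hq0 : 0 < q := by linarith
  have hp0 : 0 < p := by linarith
  obtain ⟨C, hC, h⟩ := exists_pexp_fair_rpow_le (by linarith : 2 ≤ p)
  refine ⟨(1 + C) ^ (1 / p), Real.one_le_rpow (by linarith) (by positivity), ?_⟩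
  intro m n hn
  have hn0 : (0 : ℝ) < n := by exact_mod_cast hn
  have hB : 0 < (n : ℝ) ^ (-(p * (1 / 2 - 1 / q))) := by positivity
  have hsum : ∀ x y : Fin n → Fin m,
      ∑ i : Fin n ⊕ (Fin n → Bool), Sum.elim (fun _ => (1 : ℝ))
        (fun ε => (n : ℝ) ^ (-(p * (1 / 2 - 1 / q))) * ∏ j, fairWeight n j (ε j)) i *
        |Sum.elim (fun j => ((x j : ℕ) : ℝ))
            (fun ε : Fin n → Bool => ∑ j, ((x j : ℕ) : ℝ) * boolSign (ε j)) i -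
          Sum.elim (fun j => ((y j : ℕ) : ℝ))
            (fun ε : Fin n → Bool => ∑ j, ((y j : ℕ) : ℝ) * boolSign (ε j)) i| ^ p =
      ∑ j, |gridSub x y j| ^ p + (n : ℝ) ^ (-(p * (1 / 2 - 1 / q))) *
        pexp (fairWeight n) (fun ε => |∑ j, gridSub x y j * boolSign (ε j)| ^ p) := by
    intro x y
    rw [Fintype.sum_sum_type]
    simp only [Sum.elim_inl, Sum.elim_inr, one_mul, pexp, mul_sum, gridSub, sub_mul,
      sum_sub_distrib, mul_assoc]
  refine exists_embedding_of_weighted_sum (I := Fin n ⊕ (Fin n → Bool)) hp0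
    (a := ((n : ℝ) ^ (-(p * (1 / 2 - 1 / q)))) ^ (2 * (p - q) / (q * (p - 2)))) (by positivity)
    (by positivity) (fun x y => gridDist_nonneg q x y)
    (c := Sum.elim (fun _ => (1 : ℝ))
      (fun ε => (n : ℝ) ^ (-(p * (1 / 2 - 1 / q))) * ∏ j, fairWeight n j (ε j))) ?_
    (fun x => Sum.elim (fun j => ((x j : ℕ) : ℝ))
      (fun ε : Fin n → Bool => ∑ j, ((x j : ℕ) : ℝ) * boolSign (ε j))) ?_ ?_
  · rintro (i | ε)
    · exact zero_le_one
    · exact mul_nonneg hB.le (isProbWeight_fairWeight.prod_nonneg ε)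
  · intro x y
    rw [hsum, gridDist_rpow_eq]
    exact rpow_le_of_interpolate hq hqp hB (sum_nonneg fun j _ => sq_nonneg _)
      (sum_nonneg fun j _ => by positivity) (sum_nonneg fun j _ => by positivity)
      (sum_abs_rpow_le_interpolate hq hqp (gridSub x y)) (add_le_add le_rfl
        (mul_le_mul_of_nonneg_left (le_pexp_fair_rpow (by linarith) _) hB.le))
  · intro x y
    rw [hsum, gridDist_rpow_eq]
    have h1 : ∑ j, |gridSub x y j| ^ p ≤ (∑ j, |gridSub x y j| ^ q) ^ (p / q) := by
      refine (le_of_eq (sum_congr rfl fun j _ => ?_)).trans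
        (sum_rpow_le_rpow_sum (by rw [one_le_div hq0]; exact hqp.le : 1 ≤ p / q)
          (fun j => |gridSub x y j| ^ q) fun j => by positivity)
      rw [← Real.rpow_mul (abs_nonneg _), mul_div_cancel₀ _ hq0.ne']
    have h2 : (n : ℝ) ^ (-(p * (1 / 2 - 1 / q))) *
        pexp (fairWeight n) (fun ε => |∑ j, gridSub x y j * boolSign (ε j)| ^ p) ≤
        C * (∑ j, |gridSub x y j| ^ q) ^ (p / q) := by
      refine (mul_le_mul_of_nonneg_left ((h n (gridSub x y)).trans
        (mul_le_mul_of_nonneg_left (sum_sq_rpow_le hp0.le hq _) hC.le)) hB.le).trans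
        (le_of_eq ?_)
      rw [Real.rpow_neg hn0.le]
      field_simp
    refine (add_le_add h1 h2).trans (le_of_eq ?_)
    rw [Real.mul_rpow (by positivity) (by positivity), ← Real.rpow_mul (by positivity),
      ← Real.rpow_mul (by positivity), ← Real.rpow_mul (by positivity),
      one_div_mul_cancel hp0.ne', Real.rpow_one, mul_left_comm, ← Real.rpow_add hn0]
    have e : -(p * (1 / 2 - 1 / q)) * (2 * (p - q) / (q * (p - 2))) +
        (p - q) * (q - 2) / (q ^ 2 * (p - 2)) * p = 0 := by
      field_simp
      ring
    rw [e, Real.rpow_zero]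
    ring

end RandomSumEmbedding

section TrigonometricEmbedding

lemma cos_sub_sq_add_sin_sub_sq (s t : ℝ) :
    (Real.cos s - Real.cos t) ^ 2 + (Real.sin s - Real.sin t) ^ 2 = 2 - 2 * Real.cos (s - t) := by
  rw [Real.cos_sub]
  linear_combination Real.sin_sq_add_cos_sq s + Real.sin_sq_add_cos_sq t

lemma cos_sub_sq_add_sin_sub_sq_le (s t : ℝ) :
    (Real.cos s - Real.cos t) ^ 2 + (Real.sin s - Real.sin t) ^ 2 ≤ (s - t) ^ 2 := by
  rw [cos_sub_sq_add_sin_sub_sq]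
  linarith [Real.one_sub_sq_div_two_le_cos (x := s - t)]

lemma le_cos_sub_sq_add_sin_sub_sq {s t : ℝ} (h1 : 1 ≤ |s - t|) (h2 : |s - t| ≤ 2) :
    2 * (1 - Real.cos 1) ≤ (Real.cos s - Real.cos t) ^ 2 + (Real.sin s - Real.sin t) ^ 2 := by
  rw [cos_sub_sq_add_sin_sub_sq, ← Real.cos_abs (s - t)]
  have := Real.cos_le_cos_of_nonneg_of_le_pi zero_le_one (by linarith [Real.pi_gt_three]) h1
  linarith

/-- The contribution of a single frequency. -/
noncomputable def trigGap (p s t : ℝ) : ℝ :=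
  |Real.cos s - Real.cos t| ^ p + |Real.sin s - Real.sin t| ^ p

lemma trigGap_nonneg (p s t : ℝ) : 0 ≤ trigGap p s t := by unfold trigGap; positivity

lemma trigGap_le {p : ℝ} (hp : 0 ≤ p) (s t : ℝ) : trigGap p s t ≤ 2 * |s - t| ^ p := by
  have h := cos_sub_sq_add_sin_sub_sq_le s t
  have h1 : |Real.cos s - Real.cos t| ≤ |s - t| :=
    sq_le_sq.1 (by linarith [sq_nonneg (Real.sin s - Real.sin t)])
  have h2 : |Real.sin s - Real.sin t| ≤ |s - t| :=
    sq_le_sq.1 (by linarith [sq_nonneg (Real.cos s - Real.cos t)])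
  have h3 := Real.rpow_le_rpow (abs_nonneg _) h1 hp
  have h4 := Real.rpow_le_rpow (abs_nonneg _) h2 hp
  unfold trigGap
  linarith

lemma trigGap_le_two_rpow {p : ℝ} (hp : 0 ≤ p) (s t : ℝ) : trigGap p s t ≤ 2 * 2 ^ p := by
  have h1 : |Real.cos s - Real.cos t| ≤ 2 := by
    rw [abs_le]
    constructor <;>
      linarith [Real.cos_le_one s, Real.cos_le_one t, Real.neg_one_le_cos s, Real.neg_one_le_cos t]
  have h2 : |Real.sin s - Real.sin t| ≤ 2 := by
    rw [abs_le]
    constructor <;>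
      linarith [Real.sin_le_one s, Real.sin_le_one t, Real.neg_one_le_sin s, Real.neg_one_le_sin t]
  have h3 := Real.rpow_le_rpow (abs_nonneg _) h1 hp
  have h4 := Real.rpow_le_rpow (abs_nonneg _) h2 hp
  unfold trigGap
  linarith

lemma rpow_le_trigGap {p : ℝ} (hp : 0 ≤ p) {s t : ℝ} (h1 : 1 ≤ |s - t|) (h2 : |s - t| ≤ 2) :
    (1 - Real.cos 1) ^ (p / 2) ≤ trigGap p s t := by
  have hη : 0 ≤ 1 - Real.cos 1 := by linarith [Real.cos_le_one 1]
  have key : ∀ a : ℝ, 1 - Real.cos 1 ≤ a ^ 2 → (1 - Real.cos 1) ^ (p / 2) ≤ |a| ^ p := by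
    intro a ha
    refine (Real.rpow_le_rpow hη ha (by linarith)).trans (le_of_eq ?_)
    rw [← sq_abs, ← Real.rpow_natCast, ← Real.rpow_mul (abs_nonneg _)]
    congr 1
    push_cast
    ring
  have h := le_cos_sub_sq_add_sin_sub_sq h1 h2
  have h3 : 0 ≤ |Real.cos s - Real.cos t| ^ p := by positivity
  have h4 : 0 ≤ |Real.sin s - Real.sin t| ^ p := by positivity
  unfold trigGap
  rcases le_total (1 - Real.cos 1) ((Real.cos s - Real.cos t) ^ 2) with hc | hc
  · linarith [key _ hc]
  · linarith [key (Real.sin s - Real.sin t) (by linarith)]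

/-- The weighted sum of the contributions of the frequencies `2⁻ᵏ`, `k < K`. -/
noncomputable def trigSum (p α : ℝ) (K : ℕ) (s t : ℝ) : ℝ :=
  ∑ k : Fin K, (2 : ℝ) ^ ((k : ℕ) * α) * trigGap p (s / 2 ^ (k : ℕ)) (t / 2 ^ (k : ℕ))

lemma exists_two_pow_le {K : ℕ} {y : ℝ} (h1 : 1 ≤ y) (h2 : y < 2 ^ K) :
    ∃ k : Fin K, (2 : ℝ) ^ (k : ℕ) ≤ y ∧ y ≤ 2 ^ ((k : ℕ) + 1) := by
  obtain ⟨k, hk1, hk2⟩ := exists_nat_pow_near h1 one_lt_two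
  have hk : k < K := (pow_lt_pow_iff_right₀ (one_lt_two : (1 : ℝ) < 2)).1 (hk1.trans_lt h2)
  exact ⟨⟨k, hk⟩, hk1, hk2.le⟩

lemma le_trigSum {p α : ℝ} (hp : 0 ≤ p) (hα : 0 ≤ α) {K : ℕ} {s t : ℝ} (h1 : 1 ≤ |s - t|)
    (h2 : |s - t| < 2 ^ K) :
    2 ^ (-α) * (1 - Real.cos 1) ^ (p / 2) * |s - t| ^ α ≤ trigSum p α K s t := by
  obtain ⟨k, hk1, hk2⟩ := exists_two_pow_le h1 h2
  have hpos : (0 : ℝ) < 2 ^ (k : ℕ) := by positivity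
  have hη : 0 ≤ 1 - Real.cos 1 := by linarith [Real.cos_le_one 1]
  have h3 : |s / 2 ^ (k : ℕ) - t / 2 ^ (k : ℕ)| = |s - t| / 2 ^ (k : ℕ) := by
    rw [← sub_div, abs_div, abs_of_pos hpos]
  have h4 := rpow_le_trigGap hp (s := s / 2 ^ (k : ℕ)) (t := t / 2 ^ (k : ℕ))
    (by rw [h3, one_le_div hpos]; exact hk1)
    (by rw [h3, div_le_iff₀ hpos, ← pow_succ']; exact hk2)
  have h5 : 2 ^ (-α) * |s - t| ^ α ≤ (2 : ℝ) ^ ((k : ℕ) * α) := by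
    refine (mul_le_mul_of_nonneg_left (Real.rpow_le_rpow (abs_nonneg _) hk2 hα)
      (by positivity)).trans (le_of_eq ?_)
    rw [← Real.rpow_natCast, ← Real.rpow_mul zero_le_two, ← Real.rpow_add zero_lt_two]
    congr 1
    push_cast
    ring
  refine le_trans ?_ (single_le_sum (f := fun k : Fin K => (2 : ℝ) ^ ((k : ℕ) * α) *
    trigGap p (s / 2 ^ (k : ℕ)) (t / 2 ^ (k : ℕ)))
    (fun i _ => mul_nonneg (by positivity) (trigGap_nonneg _ _ _)) (mem_univ k))
  calc 2 ^ (-α) * (1 - Real.cos 1) ^ (p / 2) * |s - t| ^ α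
      = 2 ^ (-α) * |s - t| ^ α * (1 - Real.cos 1) ^ (p / 2) := by ring
    _ ≤ _ := mul_le_mul h5 h4 (by positivity) (by positivity)

lemma trigSum_term_le {p α β : ℝ} (hα : 0 ≤ α) (hαp : α ≤ p) (hβα : β ≤ α) (hβp : β ≤ p - α)
    {k l : ℕ} {s t : ℝ} (h1 : (2 : ℝ) ^ l ≤ |s - t|) (h2 : |s - t| ≤ 2 ^ (l + 1)) :
    (2 : ℝ) ^ (k * α) * trigGap p (s / 2 ^ k) (t / 2 ^ k) ≤
      2 * 2 ^ p * |s - t| ^ α * ((2 : ℝ) ^ (-β)) ^ ((l : ℤ) - k).natAbs := by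
  have hp : 0 ≤ p := hα.trans hαp
  have hpos : (0 : ℝ) < 2 ^ k := by positivity
  have hl : (2 : ℝ) ^ (l * α) ≤ |s - t| ^ α := by
    rw [Real.rpow_mul zero_le_two, Real.rpow_natCast]
    exact Real.rpow_le_rpow (by positivity) h1 hα
  rcases le_total k l with hkl | hkl
  · obtain ⟨i, rfl⟩ := Nat.exists_eq_add_of_le hkl
    have e : (((k + i : ℕ) : ℤ) - k).natAbs = i := by omega
    rw [e]
    have h3 : (2 : ℝ) ^ (k * α) ≤ 2 ^ (((k + i : ℕ) : ℝ) * α) * ((2 : ℝ) ^ (-β)) ^ i := by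
      rw [← Real.rpow_natCast ((2 : ℝ) ^ (-β)), ← Real.rpow_mul zero_le_two,
        ← Real.rpow_add zero_lt_two]
      refine Real.rpow_le_rpow_of_exponent_le one_le_two ?_
      push_cast
      have : 0 ≤ (i : ℝ) * (α - β) := mul_nonneg (by positivity) (by linarith)
      linarith
    calc (2 : ℝ) ^ (k * α) * trigGap p (s / 2 ^ k) (t / 2 ^ k)
        ≤ (2 ^ (((k + i : ℕ) : ℝ) * α) * ((2 : ℝ) ^ (-β)) ^ i) * (2 * 2 ^ p) :=
          mul_le_mul h3 (trigGap_le_two_rpow hp _ _) (trigGap_nonneg _ _ _) (by positivity)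
      _ ≤ (|s - t| ^ α * ((2 : ℝ) ^ (-β)) ^ i) * (2 * 2 ^ p) := by gcongr
      _ = _ := by ring
  · obtain ⟨i, rfl⟩ := Nat.exists_eq_add_of_le hkl
    have e : ((l : ℤ) - ((l + i : ℕ) : ℤ)).natAbs = i := by omega
    rw [e]
    have h3 := trigGap_le hp (s / 2 ^ (l + i)) (t / 2 ^ (l + i))
    rw [← sub_div, abs_div, abs_of_pos hpos, Real.div_rpow (abs_nonneg _) hpos.le] at h3
    have h0 : 0 < |s - t| := lt_of_lt_of_le (by positivity) h1
    have h4 : |s - t| ^ p ≤ |s - t| ^ α * 2 ^ ((l + 1) * (p - α)) := by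
      have e1 : |s - t| ^ p = |s - t| ^ α * |s - t| ^ (p - α) := by
        rw [← Real.rpow_add h0]
        congr 1
        ring
      rw [e1]
      refine mul_le_mul_of_nonneg_left ((Real.rpow_le_rpow h0.le h2 (by linarith)).trans
        (le_of_eq ?_)) (by positivity)
      rw [← Real.rpow_natCast, ← Real.rpow_mul zero_le_two]
      congr 1
      push_cast
      ring
    have h5 : (2 : ℝ) ^ (((l + i : ℕ) : ℝ) * α) * (2 ^ ((l + 1) * (p - α)) /
        ((2 : ℝ) ^ (l + i)) ^ p) ≤ 2 ^ p * ((2 : ℝ) ^ (-β)) ^ i := by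
      rw [← Real.rpow_natCast ((2 : ℝ) ^ (-β)), ← Real.rpow_natCast 2 (l + i),
        ← Real.rpow_mul zero_le_two, ← Real.rpow_mul zero_le_two, ← Real.rpow_sub zero_lt_two,
        ← Real.rpow_add zero_lt_two, ← Real.rpow_add zero_lt_two]
      refine Real.rpow_le_rpow_of_exponent_le one_le_two ?_
      push_cast
      have : 0 ≤ (i : ℝ) * (p - α - β) := mul_nonneg (by positivity) (by linarith)
      linarith
    calc (2 : ℝ) ^ (((l + i : ℕ) : ℝ) * α) * trigGap p (s / 2 ^ (l + i)) (t / 2 ^ (l + i))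
        ≤ (2 : ℝ) ^ (((l + i : ℕ) : ℝ) * α) * (2 * ((|s - t| ^ α * 2 ^ ((l + 1) * (p - α))) /
          ((2 : ℝ) ^ (l + i)) ^ p)) := by
          refine mul_le_mul_of_nonneg_left (h3.trans ?_) (by positivity)
          gcongr
      _ = 2 * |s - t| ^ α * ((2 : ℝ) ^ (((l + i : ℕ) : ℝ) * α) * (2 ^ ((l + 1) * (p - α)) /
          ((2 : ℝ) ^ (l + i)) ^ p)) := by ring
      _ ≤ 2 * |s - t| ^ α * (2 ^ p * ((2 : ℝ) ^ (-β)) ^ i) :=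
          mul_le_mul_of_nonneg_left h5 (by positivity)
      _ = _ := by ring

lemma exists_trigSum_le {p α : ℝ} (hα : 0 < α) (hαp : α < p) :
    ∃ C : ℝ, 0 < C ∧ ∀ (K : ℕ) (s t : ℝ), 1 ≤ |s - t| → |s - t| < 2 ^ K →
      trigSum p α K s t ≤ C * |s - t| ^ α := by
  obtain ⟨β, hβ⟩ : ∃ β, β = min α (p - α) := ⟨_, rfl⟩
  have hβ0 : 0 < β := hβ ▸ lt_min hα (by linarith)
  have hρ0 : (0 : ℝ) < 2 ^ (-β) := by positivity
  have hρ1 : (2 : ℝ) ^ (-β) < 1 := Real.rpow_lt_one_of_one_lt_of_neg one_lt_two (by linarith)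
  have hs := summable_geometric_of_lt_one hρ0.le hρ1
  refine ⟨2 * 2 ^ p * (2 * (1 - (2 : ℝ) ^ (-β))⁻¹), ?_, ?_⟩
  · have : 0 < 1 - (2 : ℝ) ^ (-β) := by linarith
    positivity
  · intro K s t h1 h2
    obtain ⟨l, hl1, hl2⟩ := exists_two_pow_le h1 h2
    have h3 : trigSum p α K s t ≤ ∑ k : Fin K, 2 * 2 ^ p * |s - t| ^ α *
        ((2 : ℝ) ^ (-β)) ^ pathDist l k := by
      refine sum_le_sum fun k _ => ?_
      exact trigSum_term_le hα.le hαp.le (hβ ▸ min_le_left _ _) (hβ ▸ min_le_right _ _) hl1 hl2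
    refine h3.trans ?_
    rw [← mul_sum]
    have h4 := sum_pathDist_le (fun d => ((2 : ℝ) ^ (-β)) ^ d) (fun d => by positivity) hs l
    rw [tsum_geometric_of_lt_one hρ0.le hρ1] at h4
    refine (mul_le_mul_of_nonneg_left h4 (by positivity)).trans (le_of_eq ?_)
    ring

variable {n m : ℕ}

lemma abs_gridSub_le (x y : Fin n → Fin m) (j : Fin n) : |gridSub x y j| ≤ m := by
  have h1 : ((x j : ℕ) : ℝ) < m := by exact_mod_cast (x j).2
  have h2 : ((y j : ℕ) : ℝ) < m := by exact_mod_cast (y j).2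
  have h3 : (0 : ℝ) ≤ ((x j : ℕ) : ℝ) := by positivity
  have h4 : (0 : ℝ) ≤ ((y j : ℕ) : ℝ) := by positivity
  unfold gridSub
  rw [abs_le]
  constructor <;> linarith

lemma gridSub_eq_intCast (x y : Fin n → Fin m) (j : Fin n) :
    gridSub x y j = (((x j : ℕ) : ℤ) - ((y j : ℕ) : ℤ) : ℤ) := by
  unfold gridSub
  push_cast
  rfl

lemma sum_gridSub_sq_le {q : ℝ} (hq : 2 ≤ q) (x y : Fin n → Fin m) :
    ∑ j, gridSub x y j ^ 2 ≤ ∑ j, |gridSub x y j| ^ q := by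
  refine sum_le_sum fun j _ => ?_
  rw [← sq_abs, ← Real.rpow_natCast]
  rw [gridSub_eq_intCast]
  rcases eq_or_ne (((x j : ℕ) : ℤ) - ((y j : ℕ) : ℤ)) 0 with h | h
  · rw [h]
    simp [(by linarith : q ≠ 0)]
  · have h1 : (1 : ℝ) ≤ |((((x j : ℕ) : ℤ) - ((y j : ℕ) : ℤ) : ℤ) : ℝ)| := by
      exact_mod_cast Int.one_le_abs h
    exact Real.rpow_le_rpow_of_exponent_le h1 (by push_cast; exact hq)

lemma sum_abs_gridSub_rpow_le {q : ℝ} (hq : 2 ≤ q) (x y : Fin n → Fin m) :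
    ∑ j, |gridSub x y j| ^ q ≤ (m : ℝ) ^ (q - 2) * ∑ j, gridSub x y j ^ 2 := by
  rw [mul_sum]
  refine sum_le_sum fun j _ => ?_
  have e : q - 2 + 2 = q := by ring
  calc |gridSub x y j| ^ q = |gridSub x y j| ^ (q - 2) * |gridSub x y j| ^ (2 : ℝ) := by
        rw [← Real.rpow_add' (abs_nonneg _) (by rw [e]; linarith), e]
    _ = |gridSub x y j| ^ (q - 2) * gridSub x y j ^ 2 := by
        rw [Real.rpow_two, sq_abs]
    _ ≤ _ := mul_le_mul_of_nonneg_right (Real.rpow_le_rpow (abs_nonneg _)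
        (abs_gridSub_le x y j) (by linarith)) (sq_nonneg _)

lemma abs_sum_gridSub_lt (x y : Fin n → Fin m) (ε : Fin n → Bool) :
    |∑ j, gridSub x y j * boolSign (ε j)| < 2 ^ (n * m) := by
  have h1 : |∑ j, gridSub x y j * boolSign (ε j)| ≤ ((n * m : ℕ) : ℝ) := by
    refine (abs_sum_le_sum_abs _ _).trans ((sum_le_card_nsmul univ _ (m : ℝ) fun j _ => ?_).trans
      (by simp))
    rw [abs_mul, abs_boolSign, mul_one]
    exact abs_gridSub_le x y j
  refine h1.trans_lt ?_
  exact_mod_cast Nat.lt_two_pow_self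

lemma sum_gridSub_eq_intCast (x y : Fin n → Fin m) (ε : Fin n → Bool) :
    ∃ z : ℤ, ∑ j, gridSub x y j * boolSign (ε j) = z := by
  refine ⟨∑ j, (((x j : ℕ) : ℤ) - ((y j : ℕ) : ℤ)) * (if ε j then 1 else -1), ?_⟩
  push_cast
  refine sum_congr rfl fun j _ => ?_
  rw [gridSub_eq_intCast]
  cases ε j <;> simp [boolSign]

lemma exists_trigSum_bounds {p α : ℝ} (hα : 0 < α) (hαp : α < p) :
    ∃ c C : ℝ, 0 < c ∧ 0 < C ∧ ∀ (K : ℕ) (s t : ℝ), (∃ z : ℤ, s - t = z) → |s - t| < 2 ^ K →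
      c * |s - t| ^ α ≤ trigSum p α K s t ∧ trigSum p α K s t ≤ C * |s - t| ^ α := by
  obtain ⟨C, hC, h⟩ := exists_trigSum_le hα hαp
  have hη : 0 < 1 - Real.cos 1 := by linarith [Real.cos_one_le]
  refine ⟨2 ^ (-α) * (1 - Real.cos 1) ^ (p / 2), C, by positivity, hC, ?_⟩
  rintro K s t ⟨z, hz⟩ hK
  rcases eq_or_ne z 0 with rfl | hz0
  · have hst : s = t := by simpa [sub_eq_zero] using hz
    subst hst
    have hp : p ≠ 0 := by linarith
    simp [trigSum, trigGap, hp, hα.ne']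
  · have h1 : 1 ≤ |s - t| := by
      rw [hz]
      exact_mod_cast Int.one_le_abs hz0
    exact ⟨le_trigSum (by linarith) hα.le h1 hK, h K s t h1 hK⟩

/-- The distortion bound given by trigonometric functions of random sums. -/
theorem exists_embedding_rpow_side {p q : ℝ} (hq : 2 < q) (hqp : q < p) :
    ∃ C : ℝ, 1 ≤ C ∧ ∀ m n : ℕ, 0 < m →
      ∃ f : (Fin n → Fin m) → LpSpace p, ∀ x y, gridDist q x y ≤ ‖f x - f y‖ ∧ ‖f x - f y‖ ≤
        C * (m : ℝ) ^ (1 - 2 / q) * gridDist q x y := by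
  have hq0 : 0 < q := by linarith
  have hp0 : 0 < p := by linarith
  obtain ⟨α, hα⟩ : ∃ α, α = 2 * (p / q) := ⟨_, rfl⟩
  have hpq : 1 < p / q := by rwa [one_lt_div hq0]
  have hα2 : 2 ≤ α := by linarith
  have hαp : α < p := by
    rw [hα, ← mul_div_assoc, div_lt_iff₀ hq0]
    nlinarith
  have hα' : α / 2 = p / q := by linarith
  obtain ⟨c₁, C₁, hc₁, hC₁, h₁⟩ := exists_trigSum_bounds (by linarith : 0 < α) hαp
  obtain ⟨C₂, hC₂, h₂⟩ := exists_pexp_fair_rpow_le hα2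
  refine ⟨max 1 ((C₁ * C₂ / c₁) ^ (1 / p)), le_max_left _ _, ?_⟩
  intro m n hm
  have hm0 : (0 : ℝ) < m := by exact_mod_cast hm
  have hsub : ∀ (x y : Fin n → Fin m) (ε : Fin n → Bool),
      ∑ j, ((x j : ℕ) : ℝ) * boolSign (ε j) - ∑ j, ((y j : ℕ) : ℝ) * boolSign (ε j) =
        ∑ j, gridSub x y j * boolSign (ε j) := fun x y ε => by
    simp only [gridSub, sub_mul, sum_sub_distrib]
  have hbounds : ∀ (x y : Fin n → Fin m) (ε : Fin n → Bool),
      c₁ * |∑ j, gridSub x y j * boolSign (ε j)| ^ α ≤ trigSum p α (n * m)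
        (∑ j, ((x j : ℕ) : ℝ) * boolSign (ε j)) (∑ j, ((y j : ℕ) : ℝ) * boolSign (ε j)) ∧
      trigSum p α (n * m) (∑ j, ((x j : ℕ) : ℝ) * boolSign (ε j))
        (∑ j, ((y j : ℕ) : ℝ) * boolSign (ε j)) ≤
        C₁ * |∑ j, gridSub x y j * boolSign (ε j)| ^ α := by
    intro x y ε
    have := h₁ (n * m) (∑ j, ((x j : ℕ) : ℝ) * boolSign (ε j))
      (∑ j, ((y j : ℕ) : ℝ) * boolSign (ε j))
    rw [hsub] at this
    exact this (sum_gridSub_eq_intCast x y ε) (abs_sum_gridSub_lt x y ε)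
  have hκ := isProbWeight_fairWeight (n := n)
  let c : (Fin n → Bool) × Fin (n * m) × Bool → ℝ := fun i =>
    (∏ j, fairWeight n j (i.1 j)) * (2 : ℝ) ^ ((i.2.1 : ℕ) * α)
  let F : (Fin n → Fin m) → (Fin n → Bool) × Fin (n * m) × Bool → ℝ := fun x i =>
    if i.2.2 then Real.cos ((∑ j, ((x j : ℕ) : ℝ) * boolSign (i.1 j)) / 2 ^ (i.2.1 : ℕ))
    else Real.sin ((∑ j, ((x j : ℕ) : ℝ) * boolSign (i.1 j)) / 2 ^ (i.2.1 : ℕ))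
  have hsum : ∀ x y, ∑ i, c i * |F x i - F y i| ^ p = pexp (fairWeight n) (fun ε =>
      trigSum p α (n * m) (∑ j, ((x j : ℕ) : ℝ) * boolSign (ε j))
        (∑ j, ((y j : ℕ) : ℝ) * boolSign (ε j))) := by
    intro x y
    rw [Fintype.sum_prod_type]
    unfold pexp
    refine sum_congr rfl fun ε _ => ?_
    beta_reduce
    rw [Fintype.sum_prod_type]
    unfold trigSum
    rw [mul_sum]
    refine sum_congr rfl fun k _ => ?_
    rw [Fintype.sum_bool]
    simp only [c, F, if_true, Bool.false_eq_true, if_false, trigGap]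
    ring
  have hmr : ((m : ℝ) ^ (1 - 2 / q)) ^ p = (m : ℝ) ^ ((q - 2) * (p / q)) := by
    rw [← Real.rpow_mul hm0.le]
    congr 1
    field_simp
  refine exists_embedding_of_weighted_sum hp0
    (a := c₁ * (m : ℝ) ^ (-((q - 2) * (p / q)))) (by positivity) (by positivity)
    (fun x y => gridDist_nonneg q x y) (c := c) (fun i => ?_) F ?_ ?_
  · exact mul_nonneg (hκ.prod_nonneg _) (by positivity)
  · intro x y
    rw [hsum, gridDist_rpow_eq]
    refine le_trans ?_ (pexp_mono hκ fun ε => (hbounds x y ε).1)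
    rw [pexp_const_mul, mul_assoc]
    refine mul_le_mul_of_nonneg_left ?_ hc₁.le
    refine le_trans ?_ (le_pexp_fair_rpow hα2 _)
    rw [hα', Real.rpow_neg hm0.le, inv_mul_le_iff₀ (by positivity), Real.rpow_mul hm0.le,
      ← Real.mul_rpow (by positivity) (sum_nonneg fun j _ => sq_nonneg _)]
    exact Real.rpow_le_rpow (sum_nonneg fun j _ => by positivity)
      (sum_abs_gridSub_rpow_le hq.le x y) (by positivity)
  · intro x y
    rw [hsum, gridDist_rpow_eq]
    have hS : 0 ≤ (∑ j, |gridSub x y j| ^ q) ^ (p / q) :=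
      Real.rpow_nonneg (sum_nonneg fun j _ => by positivity) _
    have h3 : pexp (fairWeight n) (fun ε =>
        trigSum p α (n * m) (∑ j, ((x j : ℕ) : ℝ) * boolSign (ε j))
        (∑ j, ((y j : ℕ) : ℝ) * boolSign (ε j))) ≤
        C₁ * (C₂ * (∑ j, |gridSub x y j| ^ q) ^ (p / q)) := by
      refine (pexp_mono hκ fun ε => (hbounds x y ε).2).trans ?_
      rw [pexp_const_mul]
      refine mul_le_mul_of_nonneg_left ((h₂ n _).trans ?_) hC₁.le
      rw [hα']
      exact mul_le_mul_of_nonneg_left (Real.rpow_le_rpow (sum_nonneg fun j _ => sq_nonneg _)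
        (sum_gridSub_sq_le hq.le x y) (by positivity)) hC₂.le
    refine h3.trans ?_
    rw [Real.mul_rpow (by positivity) (by positivity), hmr]
    have h4 : C₁ * C₂ / c₁ ≤ max 1 ((C₁ * C₂ / c₁) ^ (1 / p)) ^ p := by
      refine le_trans (le_of_eq ?_) (Real.rpow_le_rpow (by positivity) (le_max_right _ _) hp0.le)
      rw [← Real.rpow_mul (by positivity), one_div_mul_cancel hp0.ne', Real.rpow_one]
    rw [div_le_iff₀ hc₁] at h4
    calc C₁ * (C₂ * (∑ j, |gridSub x y j| ^ q) ^ (p / q))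
        = C₁ * C₂ * (∑ j, |gridSub x y j| ^ q) ^ (p / q) := by ring
      _ ≤ max 1 ((C₁ * C₂ / c₁) ^ (1 / p)) ^ p * c₁ * (∑ j, |gridSub x y j| ^ q) ^ (p / q) :=
          mul_le_mul_of_nonneg_right h4 hS
      _ = _ := by
          rw [Real.rpow_neg hm0.le]
          field_simp

end TrigonometricEmbedding

lemma LpDistortion_le {p T : ℝ} (hT : 1 ≤ T) {X : Type*} {d : X → X → ℝ}
    (h : ∃ f : X → LpSpace p, ∀ x y, d x y ≤ ‖f x - f y‖ ∧ ‖f x - f y‖ ≤ T * d x y) :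
    LpDistortion p d ≤ T :=
  csInf_le ⟨1, fun _ hD => hD.1⟩ ⟨hT, h⟩

lemma exists_embedding_min {p q : ℝ} (hq : 2 ≤ q) (hqp : q < p) :
    ∃ C : ℝ, 1 ≤ C ∧ ∀ m n : ℕ, 0 < m → 0 < n →
      ∃ f : (Fin n → Fin m) → LpSpace p, ∀ x y, gridDist q x y ≤ ‖f x - f y‖ ∧ ‖f x - f y‖ ≤
        C * min ((n : ℝ) ^ ((p - q) * (q - 2) / (q ^ 2 * (p - 2)))) ((m : ℝ) ^ (1 - 2 / q)) *
          gridDist q x y := by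
  obtain ⟨C₁, hC₁, h₁⟩ := exists_embedding_rpow_dim hq hqp
  rcases hq.eq_or_lt with rfl | hq2
  · refine ⟨C₁, hC₁, fun m n _ hn => ?_⟩
    have := h₁ m n hn
    simpa using this
  · obtain ⟨C₂, hC₂, h₂⟩ := exists_embedding_rpow_side hq2 hqp
    refine ⟨max C₁ C₂, hC₁.trans (le_max_left _ _), fun m n hm hn => ?_⟩
    rcases min_choice ((n : ℝ) ^ ((p - q) * (q - 2) / (q ^ 2 * (p - 2))))
      ((m : ℝ) ^ (1 - 2 / q)) with h | h <;> rw [h]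
    · obtain ⟨f, hf⟩ := h₁ m n hn
      refine ⟨f, fun x y => ⟨(hf x y).1, (hf x y).2.trans ?_⟩⟩
      refine mul_le_mul_of_nonneg_right ?_ (gridDist_nonneg q x y)
      exact mul_le_mul_of_nonneg_right (le_max_left _ _) (by positivity)
    · obtain ⟨f, hf⟩ := h₂ m n hm
      refine ⟨f, fun x y => ⟨(hf x y).1, (hf x y).2.trans ?_⟩⟩
      refine mul_le_mul_of_nonneg_right ?_ (gridDist_nonneg q x y)
      exact mul_le_mul_of_nonneg_right (le_max_right _ _) (by positivity)

/-- **Theorem 1.1: sharp evaluation of the `L_p` distortion of `ℓ_q^n` grids.**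
If `2 ≤ q < p < ∞`, then there are `c, C > 0` depending only on `p, q` such that for all
`m, n ∈ ℕ`, `c_p([m]_q^n) ≍ min{n^{(p-q)(q-2)/(q²(p-2))}, m^{1-2/q}}`. -/
theorem grid_distortion_formula (p q : ℝ) (hp : 2 ≤ p) (hq : 2 ≤ q) (hqp : q < p) :
    ∃ c C : ℝ, 0 < c ∧ 0 < C ∧ ∀ m n : ℕ, 0 < m → 0 < n →
      c * min ((n : ℝ) ^ ((p - q) * (q - 2) / (q ^ 2 * (p - 2))))
            ((m : ℝ) ^ (1 - 2 / q)) ≤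
          LpDistortion p (fun x y : Fin n → Fin m => gridDist q x y) ∧
        LpDistortion p (fun x y : Fin n → Fin m => gridDist q x y) ≤
          C * min ((n : ℝ) ^ ((p - q) * (q - 2) / (q ^ 2 * (p - 2))))
            ((m : ℝ) ^ (1 - 2 / q)) := by
  have hq0 : 0 < q := by linarith
  obtain ⟨c, hc, hlow⟩ := exists_le_distortion hq hqp
  obtain ⟨C, hC, hup⟩ := exists_embedding_min hq hqp
  refine ⟨c, C, hc, by linarith, fun m n hm hn => ?_⟩
  have h1 : 1 ≤ min ((n : ℝ) ^ ((p - q) * (q - 2) / (q ^ 2 * (p - 2))))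
      ((m : ℝ) ^ (1 - 2 / q)) := by
    refine le_min (Real.one_le_rpow (by exact_mod_cast hn) ?_)
      (Real.one_le_rpow (by exact_mod_cast hm) ?_)
    · exact div_nonneg (mul_nonneg (by linarith) (by linarith))
        (mul_nonneg (by positivity) (by linarith))
    · rw [sub_nonneg, div_le_one hq0]
      exact hq
  have h2 := one_le_mul_of_one_le_of_one_le hC h1
  refine ⟨le_csInf ⟨_, h2, hup m n hm hn⟩ ?_, LpDistortion_le h2 (hup m n hm hn)⟩
  rintro D ⟨hD, f, hf⟩
  exact hlow m n hm hn D hD f hf
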